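/- arXiv:2605.23633 — 4 statements merged into one kernel-verified Lean document; each statement's English description precedes it below -/
import Mathlib

section
/- (Proper Grafting Lemma) If G is a balanced global type tree and p ∈ parts(G), then G has a p-grafting: there exist a g-context C and an indexed set of global type trees {G_j}_{j∈J} such that C[G_j]_{j∈J} = G, p ∉ parts(C), and every G_j is of the form end, p→q{ℓ_i(S_i).H_i}_{i∈I} or q→p{ℓ_i(S_i).H_i}_{i∈I} for some participant q. -/
set_option maxHeartbeats 1000000

/-! # Multiparty session types: global/local type trees and session calculus -/

/-- Participants. -/
abbrev Prt : Type := ℕ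

/-- Sorts. -/
inductive Srt : Type
  | nat | int | bool
  deriving DecidableEq

/-- Subsorting: the least reflexive relation with `nat ≤: int`. -/
inductive Subsort : Srt → Srt → Prop
  | refl (s : Srt) : Subsort s s
  | natint : Subsort .nat .int

/-! ## Local type trees (coinductive trees as coherent path labellings) -/

/-- Node labels of local type trees: the continuation list stores, at position `ℓ`,
`some S` when message label `ℓ` is present with payload sort `S`. -/
inductive LHead : Type
  | endH : LHead
  | recvH (p : Prt) (cs : List (Option Srt)) : LHead
  | sendH (p : Prt) (cs : List (Option Srt)) : LHead
  deriving DecidableEq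

/-- `h.branch i` : `i` is a valid child index of a node with head `h`. -/
def LHead.branch : LHead → ℕ → Prop
  | .endH, _ => False
  | .recvH _ cs, i => ∃ S, cs[i]? = some (some S)
  | .sendH _ cs, i => ∃ S, cs[i]? = some (some S)

/-- Local type trees: possibly infinite trees, represented by the assignment of a head
to each path from the root (paths are read root-first, extended at the right end). -/
structure Ltt : Type where
  node : List ℕ → Option LHead
  root : node [] ≠ none
  coh : ∀ l i, (node (l ++ [i]) ≠ none ↔ ∃ h, node l = some h ∧ h.branch i)

/-- The `i`-th child subtree of a local type tree (junk value if `i` is not a valid branch). -/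
noncomputable def Ltt.child (T : Ltt) (i : ℕ) : Ltt :=
  haveI := Classical.propDecidable (∃ T' : Ltt, ∀ l, T'.node l = T.node (i :: l))
  if h : ∃ T' : Ltt, ∀ l, T'.node l = T.node (i :: l) then h.choose else T

/-- One-step unfolding of the subtyping relation. -/
def SubF (R : Ltt → Ltt → Prop) (T T' : Ltt) : Prop :=
  (T.node [] = some .endH ∧ T'.node [] = some .endH) ∨
  (∃ p cs cs', T.node [] = some (.recvH p cs) ∧ T'.node [] = some (.recvH p cs') ∧
    ∀ i S', cs'[i]? = some (some S') →
      ∃ S, cs[i]? = some (some S) ∧ Subsort S' S ∧ R (T.child i) (T'.child i)) ∨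
  (∃ p cs cs', T.node [] = some (.sendH p cs) ∧ T'.node [] = some (.sendH p cs') ∧
    ∀ i S, cs[i]? = some (some S) →
      ∃ S', cs'[i]? = some (some S') ∧ Subsort S S' ∧ R (T.child i) (T'.child i))

/-- Subtyping: the largest relation `R` with `R ⊆ SubF R`. -/
def SubT (T T' : Ltt) : Prop :=
  ∃ R : Ltt → Ltt → Prop, (∀ a b, R a b → SubF R a b) ∧ R T T'

/-! ## Global type trees -/

/-- Node labels of global type trees. -/
inductive GHead : Type
  | endH : GHead
  | commH (p q : Prt) (cs : List (Option Srt)) : GHead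
  deriving DecidableEq

def GHead.branch : GHead → ℕ → Prop
  | .endH, _ => False
  | .commH _ _ cs, i => ∃ S, cs[i]? = some (some S)

/-- Global type trees. -/
structure Gtt : Type where
  node : List ℕ → Option GHead
  root : node [] ≠ none
  coh : ∀ l i, (node (l ++ [i]) ≠ none ↔ ∃ h, node l = some h ∧ h.branch i)

/-- The `i`-th child subtree of a global type tree (junk value if `i` is invalid). -/
noncomputable def Gtt.child (G : Gtt) (i : ℕ) : Gtt :=
  haveI := Classical.propDecidable (∃ G' : Gtt, ∀ l, G'.node l = G.node (i :: l))
  if h : ∃ G' : Gtt, ∀ l, G'.node l = G.node (i :: l) then h.choose else G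

/-- `IsPart r G` : `r ∈ parts(G)` (the least such set of participants). -/
inductive IsPart (r : Prt) : Gtt → Prop
  | here {G : Gtt} {p q : Prt} {cs} :
      G.node [] = some (.commH p q cs) → (r = p ∨ r = q) → IsPart r G
  | there {G : Gtt} {p q : Prt} {cs i S} :
      G.node [] = some (.commH p q cs) → cs[i]? = some (some S) →
      IsPart r (G.child i) → IsPart r G

/-! ## Projection (coinductive, plain merge) -/

def ProjF (R : Gtt → Prt → Ltt → Prop) (G : Gtt) (r : Prt) (T : Ltt) : Prop :=
  (¬ IsPart r G → T.node [] = some .endH) ∧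
  (∀ p cs, G.node [] = some (.commH p r cs) →
    T.node [] = some (.recvH p cs) ∧
    ∀ i S, cs[i]? = some (some S) → R (G.child i) r (T.child i)) ∧
  (∀ q cs, G.node [] = some (.commH r q cs) →
    T.node [] = some (.sendH q cs) ∧
    ∀ i S, cs[i]? = some (some S) → R (G.child i) r (T.child i)) ∧
  (∀ p q cs, G.node [] = some (.commH p q cs) → r ≠ p → r ≠ q →
    ∀ i S, cs[i]? = some (some S) → R (G.child i) r T)

/-- Projection `G ↾ r T`: the largest relation satisfying the projection clauses. -/
def Proj (G : Gtt) (r : Prt) (T : Ltt) : Prop :=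
  ∃ R : Gtt → Prt → Ltt → Prop, (∀ g p t, R g p t → ProjF R g p t) ∧ R G r T

/-- `G` is projectable onto every participant. -/
def Projectable (G : Gtt) : Prop := ∀ p, ∃ T, Proj G p T

/-! ## Balancedness -/

/-- `Subtree G G'` : `G'` is a subtree of `G`. -/
inductive Subtree : Gtt → Gtt → Prop
  | refl (G : Gtt) : Subtree G G
  | child {G G' : Gtt} {p q : Prt} {cs i S} :
      Subtree G G' → G'.node [] = some (.commH p q cs) → cs[i]? = some (some S) →
      Subtree G (G'.child i)

/-- `Occ r k G` : the participant `r` occurs on every path from the root of `G` that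
has length at least `k` or ends in `end`. -/
inductive Occ (r : Prt) : ℕ → Gtt → Prop
  | here {k} {G : Gtt} {p q : Prt} {cs} :
      G.node [] = some (.commH p q cs) → (r = p ∨ r = q) → Occ r k G
  | step {k} {G : Gtt} {p q : Prt} {cs} :
      G.node [] = some (.commH p q cs) →
      (∀ i S, cs[i]? = some (some S) → Occ r k (G.child i)) → Occ r (k + 1) G

/-- Balanced global type trees. -/
def BalancedG (G : Gtt) : Prop :=
  ∀ G', Subtree G G' → ∃ k, ∀ r, IsPart r G' → Occ r k G'

/-! ## g-contexts and grafting -/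

/-- Global type tree contexts (finite prefixes with numbered holes). -/
inductive GCtx : Type
  | hole (j : ℕ) : GCtx
  | comm (p q : Prt) (cs : List (Option (Srt × GCtx))) : GCtx

/-- Participants of a g-context. -/
inductive CtxPart (r : Prt) : GCtx → Prop
  | here {p q : Prt} {cs} : (r = p ∨ r = q) → CtxPart r (.comm p q cs)
  | there {p q : Prt} {cs : List (Option (Srt × GCtx))} {i : ℕ} {S : Srt} {C : GCtx} :
      cs[i]? = some (some (S, C)) → CtxPart r C → CtxPart r (.comm p q cs)

/-- `Graft σ C G` : grafting the indexed family `σ` of global type trees onto the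
g-context `C` yields the global type tree `G`. -/
inductive Graft (σ : ℕ → Option Gtt) : GCtx → Gtt → Prop
  | hole {j : ℕ} {G : Gtt} : σ j = some G → Graft σ (.hole j) G
  | comm {p q : Prt} {cs : List (Option (Srt × GCtx))} {G : Gtt} :
      G.node [] = some (.commH p q (cs.map (Option.map Prod.fst))) →
      (∀ i S C, cs[i]? = some (some (S, C)) → Graft σ C (G.child i)) →
      Graft σ (.comm p q cs) G

/-- `Gj` has the shape `end`, `p→q{…}` or `q→p{…}` for some `q`. -/
def GoodAt (p : Prt) (Gj : Gtt) : Prop :=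
  Gj.node [] = some .endH ∨
  (∃ q cs, Gj.node [] = some (.commH p q cs)) ∨
  (∃ q cs, Gj.node [] = some (.commH q p cs))

/-! ## Transition labels and local type environments -/

/-- Transition labels: `recvL p q S ℓ` = `p?q:ℓ(S)` (p receives from q),
`sendL p q S ℓ` = `p!q:ℓ(S)` (p sends to q), `commL p q ℓ` = `(p,q)ℓ`. -/
inductive TLabel : Type
  | recvL (p q : Prt) (S : Srt) (l : ℕ)
  | sendL (p q : Prt) (S : Srt) (l : ℕ)
  | commL (p q : Prt) (l : ℕ)

def TLabel.subj : TLabel → Set Prt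
  | .recvL p _ _ _ => {p}
  | .sendL p _ _ _ => {p}
  | .commL p q _ => {p, q}

/-- Local type environments: finite maps from participants to local type trees. -/
abbrev Env : Type := Prt → Option Ltt

/-- The environment is a *finite* map. -/
def EnvFin (Γ : Env) : Prop := {p : Prt | Γ p ≠ none}.Finite

def Env.single (p : Prt) (T : Ltt) : Env := fun r => if r = p then some T else none
def Env.upd (Γ : Env) (p : Prt) (T : Ltt) : Env := fun r => if r = p then some T else Γ r
def Env.union (Γ₁ Γ₂ : Env) : Env := fun r => (Γ₁ r).orElse (fun _ => Γ₂ r)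
def Env.disj (Γ₁ Γ₂ : Env) : Prop := ∀ r, Γ₁ r = none ∨ Γ₂ r = none

/-- Typing environment transitions. -/
inductive EStep : Env → TLabel → Env → Prop
  | recv {p q : Prt} {T : Ltt} {cs k S} :
      T.node [] = some (.recvH q cs) → cs[k]? = some (some S) →
      EStep (Env.single p T) (.recvL p q S k) (Env.single p (T.child k))
  | send {p q : Prt} {T : Ltt} {cs k S} :
      T.node [] = some (.sendH q cs) → cs[k]? = some (some S) →
      EStep (Env.single p T) (.sendL p q S k) (Env.single p (T.child k))
  | ext {Γ Γ' : Env} {α : TLabel} {p : Prt} {T : Ltt} :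
      EStep Γ α Γ' → Γ p = none →
      EStep (Γ.upd p T) α (Γ'.upd p T)
  | comm {Γ₁ Γ₁' Γ₂ Γ₂' : Env} {p q : Prt} {S S' : Srt} {k : ℕ} :
      EStep Γ₁ (.sendL p q S k) Γ₁' → EStep Γ₂ (.recvL q p S' k) Γ₂' →
      Subsort S S' → Env.disj Γ₁ Γ₂ →
      EStep (Γ₁.union Γ₂) (.commL p q k) (Γ₁'.union Γ₂')

/-- `Γ --α-->` : some `α`-transition is enabled. -/
def CanE (Γ : Env) (α : TLabel) : Prop := ∃ Γ', EStep Γ α Γ'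

/-- `Γ → Γ'` : a synchronised communication reduction. -/
def EnvRed (Γ Γ' : Env) : Prop := ∃ p q l, EStep Γ (.commL p q l) Γ'

/-! ## Global type transitions (coinductive) -/

def GStepF (R : Gtt → TLabel → Gtt → Prop) (G : Gtt) (α : TLabel) (G' : Gtt) : Prop :=
  (∃ p q cs k S, G.node [] = some (.commH p q cs) ∧ cs[k]? = some (some S) ∧
    α = .commL p q k ∧ G' = G.child k) ∨
  (∃ p q cs, G.node [] = some (.commH p q cs) ∧ G'.node [] = some (.commH p q cs) ∧
    α.subj ∩ ({p, q} : Set Prt) = ∅ ∧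
    (∀ i S, cs[i]? = some (some S) →
      IsPart p (G.child i) ∧ IsPart q (G.child i) ∧ R (G.child i) α (G'.child i)))

/-- Global type transitions: the largest relation `R` with `R ⊆ GStepF R`. -/
def GStep (G : Gtt) (α : TLabel) (G' : Gtt) : Prop :=
  ∃ R : Gtt → TLabel → Gtt → Prop, (∀ a b c, R a b c → GStepF R a b c) ∧ R G α G'

/-! ## Association -/

/-- `Γ ⊨ G` : the local type environment `Γ` is associated with the global type tree `G`. -/
def Assoc (Γ : Env) (G : Gtt) : Prop :=
  (∀ p, IsPart p G → ∃ T Tp, Γ p = some T ∧ Proj G p Tp ∧ SubT T Tp) ∧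
  (∀ p, ¬ IsPart p G → Γ p = none ∨ ∃ T, Γ p = some T ∧ T.node [] = some .endH)

/-- `Γ` is the environment of direct projections of `G`:
`Γ = { p : G↾p | p ∈ parts(G) }`. -/
def IsProjEnv (G : Gtt) (Γ : Env) : Prop :=
  (∀ p, IsPart p G → ∃ T, Γ p = some T ∧ Proj G p T) ∧
  (∀ p, ¬ IsPart p G → Γ p = none)

/-! ## Safety of environments -/

def SafeF (R : Env → Prop) (Γ : Env) : Prop :=
  (∀ p q S S' k k', CanE Γ (.sendL p q S k) → CanE Γ (.recvL q p S' k') →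
    CanE Γ (.commL p q k)) ∧
  (∀ p q k Γ', EStep Γ (.commL p q k) Γ' → R Γ')

/-- `safe` : the largest set of environments closed under the safety clauses. -/
def Safe (Γ : Env) : Prop :=
  ∃ R : Env → Prop, (∀ a, R a → SafeF R a) ∧ R Γ

/-! ## Environment reduction paths, fairness and liveness -/

/-- A possibly infinite environment reduction path
`Γ₀ --(p₀,q₀)ℓ₀--> Γ₁ --(p₁,q₁)ℓ₁--> ⋯`; `alive n` means the `n`-th transition exists. -/
structure EnvPath : Type where
  st : ℕ → Env
  lb : ℕ → Prt × Prt × ℕ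
  alive : ℕ → Prop
  down : ∀ n, alive (n + 1) → alive n
  step : ∀ n, alive n →
    EStep (st n) (.commL (lb n).1 (lb n).2.1 (lb n).2.2) (st (n + 1))

/-- The state of index `n` is on the path. -/
def EnvPath.valid (ρ : EnvPath) : ℕ → Prop
  | 0 => True
  | n + 1 => ρ.alive n

/-- Fair environment reduction paths. -/
def FairEPath (ρ : EnvPath) : Prop :=
  ∀ n p q, ρ.valid n → (∃ l, CanE (ρ.st n) (.commL p q l)) →
    ∃ m, n ≤ m ∧ ρ.alive m ∧ ∃ l', ρ.lb m = (p, q, l')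

/-- Live environment reduction paths. -/
def LiveEPath (ρ : EnvPath) : Prop :=
  ∀ n, ρ.valid n →
    (∀ p q S l, CanE (ρ.st n) (.sendL p q S l) →
      ∃ m, n ≤ m ∧ ρ.alive m ∧ ∃ l', ρ.lb m = (p, q, l')) ∧
    (∀ p q S l, CanE (ρ.st n) (.recvL q p S l) →
      ∃ m, n ≤ m ∧ ρ.alive m ∧ ∃ l', ρ.lb m = (p, q, l'))

/-- Live local type environments. -/
def LiveEnv (Γ : Env) : Prop :=
  ∀ Γ', Relation.ReflTransGen EnvRed Γ Γ' →
    ∀ ρ : EnvPath, ρ.st 0 = Γ' → FairEPath ρ → LiveEPath ρ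

/-! ## Expressions -/

inductive Expr : Type
  | var (n : ℕ)
  | cnat (n : ℕ)
  | cint (z : ℤ)
  | cbool (b : Bool)
  | succ (e : Expr)
  | neg (e : Expr)
  | enot (e : Expr)
  | choice (e₁ e₂ : Expr)

def Expr.IsVal : Expr → Prop
  | .cnat _ => True
  | .cint _ => True
  | .cbool _ => True
  | _ => False

/-- Expression evaluation `e ↓ v`. -/
inductive Eval : Expr → Expr → Prop
  | vnat (n : ℕ) : Eval (.cnat n) (.cnat n)
  | vint (z : ℤ) : Eval (.cint z) (.cint z)
  | vbool (b : Bool) : Eval (.cbool b) (.cbool b)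
  | succ {e n} : Eval e (.cnat n) → Eval (.succ e) (.cnat (n + 1))
  | neg {e z} : Eval e (.cint z) → Eval (.neg e) (.cint (-z))
  | enot {e b} : Eval e (.cbool b) → Eval (.enot e) (.cbool !b)
  | chl {e₁ e₂ v} : Eval e₁ v → Eval (.choice e₁ e₂) v
  | chr {e₁ e₂ v} : Eval e₂ v → Eval (.choice e₁ e₂) v

/-- Substitution of a (closed) expression `v` for the expression variable `n`. -/
def Expr.subst (v : Expr) (n : ℕ) : Expr → Expr
  | .var m => if m = n then v else .var m
  | .cnat k => .cnat k
  | .cint z => .cint z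
  | .cbool b => .cbool b
  | .succ e => .succ (Expr.subst v n e)
  | .neg e => .neg (Expr.subst v n e)
  | .enot e => .enot (Expr.subst v n e)
  | .choice e₁ e₂ => .choice (Expr.subst v n e₁) (Expr.subst v n e₂)

/-- Expression typing (expression variables are de Bruijn indices). -/
inductive ETyp : List (Option Srt) → Expr → Srt → Prop
  | var {Θ n S} : Θ[n]? = some (some S) → ETyp Θ (.var n) S
  | cnat {Θ n} : ETyp Θ (.cnat n) .nat
  | cint {Θ z} : ETyp Θ (.cint z) .int
  | cbool {Θ b} : ETyp Θ (.cbool b) .bool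
  | succ {Θ e} : ETyp Θ e .nat → ETyp Θ (.succ e) .nat
  | neg {Θ e} : ETyp Θ e .int → ETyp Θ (.neg e) .int
  | enot {Θ e} : ETyp Θ e .bool → ETyp Θ (.enot e) .bool
  | choice {Θ e₁ e₂ S} : ETyp Θ e₁ S → ETyp Θ e₂ S → ETyp Θ (.choice e₁ e₂) S
  | sub {Θ e S S'} : ETyp Θ e S → Subsort S S' → ETyp Θ e S'

/-! ## Processes and sessions -/

/-- Processes (process and expression variables are de Bruijn indices; the receive
continuation list stores `some P` at the positions of available message labels). -/
inductive Proc : Type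
  | send (q : Prt) (l : ℕ) (e : Expr) (P : Proc)
  | recv (q : Prt) (Ps : List (Option Proc))
  | ite (e : Expr) (P Q : Proc)
  | mu (P : Proc)
  | pvar (n : ℕ)
  | inact

/-- Substitution of a (closed) value `v` for the expression variable `n` in a process. -/
inductive SubstE (v : Expr) : ℕ → Proc → Proc → Prop
  | send {n q l e P P'} : SubstE v n P P' →
      SubstE v n (.send q l e P) (.send q l (Expr.subst v n e) P')
  | recv {n q} {Ps Ps' : List (Option Proc)} :
      Ps.length = Ps'.length →
      (∀ i : ℕ, (∃ P, Ps[i]? = some (some P)) ↔ (∃ P', Ps'[i]? = some (some P'))) →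
      (∀ (i : ℕ) P P', Ps[i]? = some (some P) → Ps'[i]? = some (some P') → SubstE v (n + 1) P P') →
      SubstE v n (.recv q Ps) (.recv q Ps')
  | ite {n e P P' Q Q'} : SubstE v n P P' → SubstE v n Q Q' →
      SubstE v n (.ite e P Q) (.ite (Expr.subst v n e) P' Q')
  | mu {n P P'} : SubstE v n P P' → SubstE v n (.mu P) (.mu P')
  | pvar {n m} : SubstE v n (.pvar m) (.pvar m)
  | inact {n} : SubstE v n .inact .inact

/-- Substitution of a (closed) process `R` for the process variable `n`. -/
inductive SubstP (R : Proc) : ℕ → Proc → Proc → Prop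
  | send {n q l e P P'} : SubstP R n P P' → SubstP R n (.send q l e P) (.send q l e P')
  | recv {n q} {Ps Ps' : List (Option Proc)} :
      Ps.length = Ps'.length →
      (∀ i : ℕ, (∃ P, Ps[i]? = some (some P)) ↔ (∃ P', Ps'[i]? = some (some P'))) →
      (∀ (i : ℕ) P P', Ps[i]? = some (some P) → Ps'[i]? = some (some P') → SubstP R n P P') →
      SubstP R n (.recv q Ps) (.recv q Ps')
  | ite {n e P P' Q Q'} : SubstP R n P P' → SubstP R n Q Q' →
      SubstP R n (.ite e P Q) (.ite e P' Q')
  | mu {n P P'} : SubstP R (n + 1) P P' → SubstP R n (.mu P) (.mu P')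
  | pvarEq {n} : SubstP R n (.pvar n) R
  | pvarNe {n m} : m ≠ n → SubstP R n (.pvar m) (.pvar m)
  | inact {n} : SubstP R n .inact .inact

/-- Multiparty sessions. -/
inductive Session : Type
  | single (p : Prt) (P : Proc)
  | par (M N : Session)
  | zero

/-- Structural congruence on sessions. -/
inductive SCong : Session → Session → Prop
  | refl (M) : SCong M M
  | symm {M N} : SCong M N → SCong N M
  | trans {M N K} : SCong M N → SCong N K → SCong M K
  | parComm (M N) : SCong (.par M N) (.par N M)
  | parAssoc (M N K) : SCong (.par (.par M N) K) (.par M (.par N K))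
  | parZero (M) : SCong (.par M .zero) M
  | parCong {M M' N N'} : SCong M M' → SCong N N' → SCong (.par M N) (.par M' N')

/-- Unfolding `M ⇛ N`. -/
inductive Unfold : Session → Session → Prop
  | struct {M N} : SCong M N → Unfold M N
  | iteT {p e P Q N} : Eval e (.cbool true) →
      Unfold (.par (.single p (.ite e P Q)) N) (.par (.single p P) N)
  | iteF {p e P Q N} : Eval e (.cbool false) →
      Unfold (.par (.single p (.ite e P Q)) N) (.par (.single p Q) N)
  | recUnf {p P P' N} : SubstP (.mu P) 0 P P' →
      Unfold (.par (.single p (.mu P)) N) (.par (.single p P') N)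
  | trans {M M' N} : Unfold M M' → Unfold M' N → Unfold M N

/-- Session transition labels `(p,q)ℓ` : `p` sends to `q` with message label `ℓ`. -/
abbrev SLbl : Type := Prt × Prt × ℕ

/-- Labelled session reductions. -/
inductive SStep : Session → SLbl → Session → Prop
  | comm {p q : Prt} {Ps : List (Option Proc)} {j : ℕ} {e v : Expr} {Pj Pj' Q : Proc}
      {N : Session} :
      Ps[j]? = some (some Pj) → Eval e v → SubstE v 0 Pj Pj' →
      SStep (.par (.single p (.recv q Ps)) (.par (.single q (.send p j e Q)) N))
            (q, p, j)
            (.par (.single p Pj') (.par (.single q Q) N))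
  | unf {M M' N N' : Session} {l : SLbl} :
      Unfold M M' → SStep M' l N' → Unfold N' N → SStep M l N

/-- `M → N` : some labelled reduction. -/
def SRed (M N : Session) : Prop := ∃ l, SStep M l N

/-- `p` runs `P` in `M`. -/
inductive InSess : Session → Prt → Proc → Prop
  | single {p P} : InSess (.single p P) p P
  | parL {M N p P} : InSess M p P → InSess (.par M N) p P
  | parR {M N p P} : InSess N p P → InSess (.par M N) p P

/-- Every process of the session is inactive: `Π p_i ◁ 0`. -/
inductive AllInact : Session → Prop
  | single (p : Prt) : AllInact (.single p .inact)
  | par {M N} : AllInact M → AllInact N → AllInact (.par M N)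
  | zero : AllInact .zero

/-! ## Process and session typing -/

/-- Process typing `Θ ⊢ P : T` (expression context, process-variable context). -/
inductive PTyp : List (Option Srt) → List Ltt → Proc → Ltt → Prop
  | inact {Θe Θp T} : T.node [] = some .endH → PTyp Θe Θp .inact T
  | pvar {Θe Θp n T} : Θp[n]? = some T → PTyp Θe Θp (.pvar n) T
  | mu {Θe Θp P T} : PTyp Θe (T :: Θp) P T → PTyp Θe Θp (.mu P) T
  | ite {Θe Θp e P Q T} : ETyp Θe e .bool → PTyp Θe Θp P T → PTyp Θe Θp Q T →
      PTyp Θe Θp (.ite e P Q) T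
  | sub {Θe Θp P T T'} : PTyp Θe Θp P T → SubT T T' → PTyp Θe Θp P T'
  | recv {Θe Θp q Ps T ss} : T.node [] = some (.recvH q ss) →
      Ps.length = ss.length →
      (∀ i : ℕ, (∃ P, Ps[i]? = some (some P)) ↔ (∃ S, ss[i]? = some (some S))) →
      (∀ (i : ℕ) P S, Ps[i]? = some (some P) → ss[i]? = some (some S) →
        PTyp (some S :: Θe) Θp P (T.child i)) →
      PTyp Θe Θp (.recv q Ps) T
  | send {Θe Θp q l e P T T' S ss} : ETyp Θe e S → PTyp Θe Θp P T' →
      T.node [] = some (.sendH q ss) → ss[l]? = some (some S) →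
      (∀ i S', ss[i]? = some (some S') → i = l) →
      T.child l = T' →
      PTyp Θe Θp (.send q l e P) T

/-- Session typing `Γ ⊢ M`. -/
def SessTyp (Γ : Env) (M : Session) : Prop :=
  (∀ p P Q, InSess M p P → InSess M p Q → P = Q) ∧
  (∀ p, (∃ P, InSess M p P) ↔ Γ p ≠ none) ∧
  ∃ G : Gtt, BalancedG G ∧ Projectable G ∧ Assoc Γ G ∧
    (∀ p P, InSess M p P → ∃ T, Γ p = some T ∧ PTyp [] [] P T)

/-! ## Session reduction paths and session liveness -/

/-- A possibly infinite session reduction path. -/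
structure SPath : Type where
  st : ℕ → Session
  lb : ℕ → SLbl
  alive : ℕ → Prop
  down : ∀ n, alive (n + 1) → alive n
  step : ∀ n, alive n → SStep (st n) (lb n) (st (n + 1))

def SPath.valid (ρ : SPath) : ℕ → Prop
  | 0 => True
  | n + 1 => ρ.alive n

/-- Fair session reduction paths. -/
def FairSPath (ρ : SPath) : Prop :=
  ∀ n p q, ρ.valid n → (∃ l M', SStep (ρ.st n) (p, q, l) M') →
    ∃ m, n ≤ m ∧ ρ.alive m ∧ ∃ l', ρ.lb m = (p, q, l')

/-- Session liveness (lock-freedom under full fairness). -/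
def LiveSess (M : Session) : Prop :=
  (∀ M₁ (p q : Prt) (l : ℕ) (e : Expr) (Q : Proc) (N : Session),
    Relation.ReflTransGen SRed M M₁ →
    Unfold M₁ (.par (.single q (.send p l e Q)) N) →
    ∃ N', Relation.ReflTransGen SRed
      (.par (.single q (.send p l e Q)) N) (.par (.single q Q) N')) ∧
  (∀ M₁ (p q : Prt) (Qs : List (Option Proc)) (N : Session),
    Relation.ReflTransGen SRed M M₁ →
    Unfold M₁ (.par (.single q (.recv p Qs)) N) →
    ∃ (N' : Session) (i : ℕ) (Qi : Proc) (v : Expr) (Qi' : Proc), Qs[i]? = some (some Qi) ∧ v.IsVal ∧ SubstE v 0 Qi Qi' ∧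
      Relation.ReflTransGen SRed
        (.par (.single q (.recv p Qs)) N) (.par (.single q Qi') N'))

open Classical in
/-- The family of all subtrees of `G` of the shape `GoodAt p`, indexed by codes of paths. -/
noncomputable def goodSubtrees (G : Gtt) (p : Prt) (j : ℕ) : Option Gtt :=
  (Encodable.decode (α := List ℕ) j).bind fun l =>
    if GoodAt p (l.foldl Gtt.child G) then some (l.foldl Gtt.child G) else none

theorem GoodAt.of_goodSubtrees {G : Gtt} {p : Prt} {j : ℕ} {H : Gtt}
    (h : goodSubtrees G p j = some H) : GoodAt p H := by
  unfold goodSubtrees at h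
  rw [Option.bind_eq_some_iff] at h
  obtain ⟨l, -, h⟩ := h
  split_ifs at h with hg
  exact Option.some.inj h ▸ hg

theorem GoodAt.exists_goodSubtrees {G : Gtt} {p : Prt} {l : List ℕ}
    (h : GoodAt p (l.foldl Gtt.child G)) :
    ∃ j, goodSubtrees G p j = some (l.foldl Gtt.child G) :=
  ⟨Encodable.encode l, by simp [goodSubtrees, h]⟩

theorem not_ctxPart_hole (r : Prt) (j : ℕ) : ¬ CtxPart r (.hole j) := nofun

theorem goodAt_of_commH {H : Gtt} {r p q : Prt} {cs} (h : H.node [] = some (.commH p q cs))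
    (hr : r = p ∨ r = q) : GoodAt r H := by
  rcases hr with rfl | rfl
  · exact .inr (.inl ⟨_, _, h⟩)
  · exact .inr (.inr ⟨_, _, h⟩)

theorem GoodAt.exists_graft {G : Gtt} {p : Prt} {l : List ℕ}
    (h : GoodAt p (l.foldl Gtt.child G)) :
    ∃ C, Graft (goodSubtrees G p) C (l.foldl Gtt.child G) ∧ ¬ CtxPart p C := by
  obtain ⟨j, hj⟩ := h.exists_goodSubtrees
  exact ⟨.hole j, .hole hj, not_ctxPart_hole p j⟩

/-- If `p` occurs on every path of a subtree of `G` within bounded depth, then cutting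
the subtree at the first occurrences of `p` gives a g-context without `p`. -/
theorem Occ.exists_graft {G : Gtt} {p : Prt} {k : ℕ} {H : Gtt} (h : Occ p k H) (l : List ℕ)
    (hl : H = l.foldl Gtt.child G) :
    ∃ C, Graft (goodSubtrees G p) C H ∧ ¬ CtxPart p C := by
  induction h generalizing l with
  | here h hr => exact hl ▸ GoodAt.exists_graft (hl ▸ goodAt_of_commH h hr)
  | @step k H a b cs h _ ih =>
    by_cases hr : p = a ∨ p = b
    · exact hl ▸ GoodAt.exists_graft (hl ▸ goodAt_of_commH h hr)
    have key : ∀ i, ∃ C, ∀ S, cs[i]? = some (some S) →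
        Graft (goodSubtrees G p) C (H.child i) ∧ ¬ CtxPart p C := by
      intro i
      by_cases hS : ∃ S, cs[i]? = some (some S)
      · obtain ⟨S, hS⟩ := hS
        obtain ⟨C, hC⟩ := ih i S hS (l ++ [i]) (by simp [hl])
        exact ⟨C, fun _ _ => hC⟩
      · exact ⟨.hole 0, fun S h => (hS ⟨S, h⟩).elim⟩
    choose f hf using key
    have hget : ∀ {i S C},
        (cs.mapIdx fun i o => o.map fun S => (S, f i))[i]? = some (some (S, C)) →
        cs[i]? = some (some S) ∧ f i = C := by
      intro i S C h
      simpa [List.getElem?_mapIdx] using h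
    refine ⟨.comm a b (cs.mapIdx fun i o => o.map fun S => (S, f i)), .comm ?_ ?_, ?_⟩
    · rw [h]
      congr 2
      apply List.ext_getElem?
      intro i
      simp [List.getElem?_mapIdx, Function.comp_def]
    · intro i S C hC
      obtain ⟨hS, rfl⟩ := hget hC
      exact (hf i S hS).1
    · rintro (h | ⟨hC, hp⟩)
      · exact hr h
      · obtain ⟨hS, rfl⟩ := hget hC
        exact (hf _ _ hS).2 hp

/-- **Proper Grafting Lemma.** If `G` is a balanced global type tree and `p ∈ parts(G)`,
then `G` has a `p`-grafting: a g-context `C` and an indexed family of global type trees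
`σ` with `C[σ] = G`, `p ∉ parts(C)`, and every tree in the family of the shape
`end`, `p→q{…}` or `q→p{…}`. -/
theorem proper_grafting (G : Gtt) (p : Prt)
    (hbal : BalancedG G) (hp : IsPart p G) :
    ∃ (C : GCtx) (σ : ℕ → Option Gtt),
      Graft σ C G ∧ ¬ CtxPart p C ∧
      (∀ j Gj, σ j = some Gj →
        (Gj.node [] = some .endH ∨
         (∃ q cs, Gj.node [] = some (.commH p q cs)) ∨
         (∃ q cs, Gj.node [] = some (.commH q p cs)))) := by
  obtain ⟨k, hk⟩ := hbal G (.refl G)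
  obtain ⟨C, hC, hpC⟩ := (hk p hp).exists_graft (G := G) [] rfl
  exact ⟨C, goodSubtrees G p, hC, hpC, fun _ _ h => GoodAt.of_goodSubtrees h⟩
end

section
/- (Projection is a partial function) Let G be a balanced global type tree and r a participant. If G↾r T1 and G↾r T2, then T1 = T2. -/
set_option maxHeartbeats 1000000

namespace Ltt

theorem ext_node {T T' : Ltt} (h : ∀ l, T.node l = T'.node l) : T = T' := by
  cases T
  cases T'
  congr
  exact funext h

theorem node_append_of_eq_none (T : Ltt) {l : List ℕ} (h : T.node l = none) (m : List ℕ) :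
    T.node (l ++ m) = none := by
  induction m using List.reverseRecOn with
  | nil => simpa using h
  | append_singleton m i ih =>
    by_contra hne
    rw [← List.append_assoc] at hne
    obtain ⟨hd, hhd, -⟩ := (T.coh _ _).1 hne
    simp [ih] at hhd

theorem node_singleton_ne_none_iff (T : Ltt) {h : LHead} (hT : T.node [] = some h) (i : ℕ) :
    T.node [i] ≠ none ↔ h.branch i := by
  simpa [hT] using T.coh [] i

theorem node_cons_of_not_branch (T : Ltt) {h : LHead} (hT : T.node [] = some h) {i : ℕ}
    (hi : ¬ h.branch i) (l : List ℕ) : T.node (i :: l) = none :=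
  T.node_append_of_eq_none (not_not.1 (mt (T.node_singleton_ne_none_iff hT i).1 hi)) l

theorem child_node (T : Ltt) {h : LHead} (hT : T.node [] = some h) {i : ℕ}
    (hi : h.branch i) (l : List ℕ) : (T.child i).node l = T.node (i :: l) := by
  have hex : ∃ T' : Ltt, ∀ l, T'.node l = T.node (i :: l) :=
    ⟨⟨fun l => T.node (i :: l), (T.node_singleton_ne_none_iff hT i).2 hi,
      fun l j => T.coh (i :: l) j⟩, fun _ => rfl⟩
  rw [Ltt.child, dif_pos hex]
  exact hex.choose_spec l

/-- Trees with the same head and, below each valid branch, the same labels agree along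
every path. -/
theorem node_cons_congr {T T' : Ltt} {h : LHead} (hT : T.node [] = some h)
    (hT' : T'.node [] = some h) {i : ℕ} {l : List ℕ}
    (hc : h.branch i → (T.child i).node l = (T'.child i).node l) :
    T.node (i :: l) = T'.node (i :: l) := by
  by_cases hi : h.branch i
  · rw [← T.child_node hT hi, ← T'.child_node hT' hi, hc hi]
  · rw [T.node_cons_of_not_branch hT hi, T'.node_cons_of_not_branch hT' hi]

end Ltt

theorem Proj.unfold {G : Gtt} {r : Prt} {T : Ltt} (h : Proj G r T) : ProjF Proj G r T := by
  obtain ⟨R, hR, hG⟩ := h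
  obtain ⟨h1, h2, h3, h4⟩ := hR _ _ _ hG
  exact ⟨h1, fun p cs e => ⟨(h2 p cs e).1, fun i S hi => ⟨R, hR, (h2 p cs e).2 i S hi⟩⟩,
    fun q cs e => ⟨(h3 q cs e).1, fun i S hi => ⟨R, hR, (h3 q cs e).2 i S hi⟩⟩,
    fun p q cs e hp hq i S hi => ⟨R, hR, h4 p q cs e hp hq i S hi⟩⟩

/-- Two projections of the same global tree onto the same participant have the same head,
and their children along any valid branch are again projections of a common global tree. -/
theorem Proj.exists_head {G : Gtt} {r : Prt} {T₁ T₂ : Ltt} (h₁ : Proj G r T₁)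
    (h₂ : Proj G r T₂) :
    ∃ h : LHead, T₁.node [] = some h ∧ T₂.node [] = some h ∧
      ∀ i, h.branch i → ∃ G', Proj G' r (T₁.child i) ∧ Proj G' r (T₂.child i) := by
  by_cases hr : IsPart r G
  · induction hr with
    | @here G p q cs hG hpq =>
      obtain rfl | rfl := hpq
      · obtain ⟨n₁, c₁⟩ := h₁.unfold.2.2.1 q cs hG
        obtain ⟨n₂, c₂⟩ := h₂.unfold.2.2.1 q cs hG
        exact ⟨_, n₁, n₂, fun i ⟨S, hS⟩ => ⟨G.child i, c₁ i S hS, c₂ i S hS⟩⟩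
      · obtain ⟨n₁, c₁⟩ := h₁.unfold.2.1 p cs hG
        obtain ⟨n₂, c₂⟩ := h₂.unfold.2.1 p cs hG
        exact ⟨_, n₁, n₂, fun i ⟨S, hS⟩ => ⟨G.child i, c₁ i S hS, c₂ i S hS⟩⟩
    | @there G p q cs i S hG hS _ ih =>
      by_cases hp : r = p
      · subst hp
        obtain ⟨n₁, c₁⟩ := h₁.unfold.2.2.1 q cs hG
        obtain ⟨n₂, c₂⟩ := h₂.unfold.2.2.1 q cs hG
        exact ⟨_, n₁, n₂, fun i ⟨S, hS⟩ => ⟨G.child i, c₁ i S hS, c₂ i S hS⟩⟩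
      · by_cases hq : r = q
        · subst hq
          obtain ⟨n₁, c₁⟩ := h₁.unfold.2.1 p cs hG
          obtain ⟨n₂, c₂⟩ := h₂.unfold.2.1 p cs hG
          exact ⟨_, n₁, n₂, fun i ⟨S, hS⟩ => ⟨G.child i, c₁ i S hS, c₂ i S hS⟩⟩
        · exact ih (h₁.unfold.2.2.2 p q cs hG hp hq i S hS)
            (h₂.unfold.2.2.2 p q cs hG hp hq i S hS)
  · exact ⟨.endH, h₁.unfold.1 hr, h₂.unfold.1 hr, fun _ hi => hi.elim⟩

theorem Proj.node_eq {r : Prt} (l : List ℕ) : ∀ {G : Gtt} {T₁ T₂ : Ltt},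
    Proj G r T₁ → Proj G r T₂ → T₁.node l = T₂.node l := by
  induction l with
  | nil =>
    intro G T₁ T₂ h₁ h₂
    obtain ⟨h, n₁, n₂, -⟩ := h₁.exists_head h₂
    rw [n₁, n₂]
  | cons i l ih =>
    intro G T₁ T₂ h₁ h₂
    obtain ⟨h, n₁, n₂, hc⟩ := h₁.exists_head h₂
    refine Ltt.node_cons_congr n₁ n₂ fun hi => ?_
    obtain ⟨G', c₁, c₂⟩ := hc i hi
    exact ih c₁ c₂

/-- **Projection is a partial function.** If `G` is a balanced global type tree, `r` a
participant, `G ↾ r T₁` and `G ↾ r T₂`, then `T₁ = T₂`. -/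
theorem projection_unique (G : Gtt) (r : Prt) (T₁ T₂ : Ltt)
    (hbal : BalancedG G) (h₁ : Proj G r T₁) (h₂ : Proj G r T₂) :
    T₁ = T₂ := by
  exact Ltt.ext_node fun l => Proj.node_eq l h₁ h₂
end

section
/- (Safety by Association) Let G be a balanced, projectable global type tree and Γ a local type environment with Γ ⊨ G. Then Γ ∈ safe. -/
set_option maxHeartbeats 1000000

/-! ### Global type trees: extensionality and children -/

theorem Gtt.eq_of_node {G G' : Gtt} (h : G.node = G'.node) : G = G' := by
  cases G; cases G'; cases h; rfl

open Classical in
/-- The global type tree `p→q{ℓ_i(S_i).f i}`. -/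
noncomputable def Gtt.mkComm (p q : Prt) (cs : List (Option Srt)) (f : ℕ → Gtt) : Gtt where
  node
    | [] => some (.commH p q cs)
    | i :: l => if ∃ S, cs[i]? = some (some S) then (f i).node l else none
  root := by simp
  coh := by
    intro l i
    cases l with
    | nil =>
      have := (f i).root
      simp only [List.nil_append, Option.some.injEq, exists_eq_left', GHead.branch]
      by_cases h : ∃ S, cs[i]? = some (some S) <;> simp [h, this]
    | cons j l =>
      by_cases h : ∃ S, cs[j]? = some (some S)
      · simpa [h] using (f j).coh l i
      · simp [h]

theorem Gtt.mkComm_node_nil (p q : Prt) (cs : List (Option Srt)) (f : ℕ → Gtt) :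
    (Gtt.mkComm p q cs f).node [] = some (.commH p q cs) := rfl

theorem Gtt.mkComm_child (p q : Prt) {cs : List (Option Srt)} (f : ℕ → Gtt) {i : ℕ} {S : Srt}
    (h : cs[i]? = some (some S)) : (Gtt.mkComm p q cs f).child i = f i := by
  have hnode : ∀ l, (f i).node l = (Gtt.mkComm p q cs f).node (i :: l) := by
    intro l
    simp [Gtt.mkComm, h]
  have hex : ∃ G' : Gtt, ∀ l, G'.node l = (Gtt.mkComm p q cs f).node (i :: l) := ⟨_, hnode⟩
  unfold Gtt.child
  rw [dif_pos hex]
  exact Gtt.eq_of_node (funext fun l => (hex.choose_spec l).trans (hnode l).symm)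

/-! ### Unfolding of the coinductive relations -/

theorem Subsort.trans {a b c : Srt} (h : Subsort a b) (h' : Subsort b c) : Subsort a c := by
  cases h with
  | refl => exact h'
  | natint => cases h'; exact .natint

theorem SubF.mono {R R' : Ltt → Ltt → Prop} (hR : ∀ a b, R a b → R' a b) {T T' : Ltt}
    (h : SubF R T T') : SubF R' T T' := by
  rcases h with h | ⟨p, cs, cs', h, h', H⟩ | ⟨p, cs, cs', h, h', H⟩
  · exact .inl h
  · refine .inr (.inl ⟨p, cs, cs', h, h', fun i S hS => ?_⟩)
    obtain ⟨S', h1, h2, h3⟩ := H i S hS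
    exact ⟨S', h1, h2, hR _ _ h3⟩
  · refine .inr (.inr ⟨p, cs, cs', h, h', fun i S hS => ?_⟩)
    obtain ⟨S', h1, h2, h3⟩ := H i S hS
    exact ⟨S', h1, h2, hR _ _ h3⟩

theorem SubT.unfold {T T' : Ltt} (h : SubT T T') : SubF SubT T T' := by
  obtain ⟨R, hR, h⟩ := h
  exact (hR _ _ h).mono fun _ _ h => ⟨R, hR, h⟩

theorem SubT.of_sendH {T T' : Ltt} {q cs} (h : SubT T T') (hT : T.node [] = some (.sendH q cs)) :
    ∃ cs', T'.node [] = some (.sendH q cs') ∧ ∀ i S, cs[i]? = some (some S) →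
      ∃ S', cs'[i]? = some (some S') ∧ Subsort S S' ∧ SubT (T.child i) (T'.child i) := by
  rcases h.unfold with ⟨h, _⟩ | ⟨_, _, _, h, _⟩ | ⟨p, c, cs', h, h', H⟩
  · simp [hT] at h
  · simp [hT] at h
  · rw [hT] at h
    cases h
    exact ⟨cs', h', H⟩

theorem SubT.of_recvH {T T' : Ltt} {q cs} (h : SubT T T') (hT : T.node [] = some (.recvH q cs)) :
    ∃ cs', T'.node [] = some (.recvH q cs') ∧ ∀ i S', cs'[i]? = some (some S') →
      ∃ S, cs[i]? = some (some S) ∧ Subsort S' S ∧ SubT (T.child i) (T'.child i) := by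
  rcases h.unfold with ⟨h, _⟩ | ⟨p, c, cs', h, h', H⟩ | ⟨_, _, _, h, _⟩
  · simp [hT] at h
  · rw [hT] at h
    cases h
    exact ⟨cs', h', H⟩
  · simp [hT] at h

theorem SubT.endH {T T' : Ltt} (h : SubT T T') (hT' : T'.node [] = some .endH) :
    T.node [] = some .endH := by
  rcases h.unfold with ⟨h, _⟩ | ⟨_, _, _, _, h, _⟩ | ⟨_, _, _, _, h, _⟩
  · exact h
  · simp [hT'] at h
  · simp [hT'] at h

theorem ProjF.mono {R R' : Gtt → Prt → Ltt → Prop} (hR : ∀ g r t, R g r t → R' g r t)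
    {G : Gtt} {r : Prt} {T : Ltt} (h : ProjF R G r T) : ProjF R' G r T := by
  obtain ⟨h1, h2, h3, h4⟩ := h
  exact ⟨h1, fun p cs hG => ⟨(h2 p cs hG).1, fun i S hS => hR _ _ _ ((h2 p cs hG).2 i S hS)⟩,
    fun q cs hG => ⟨(h3 q cs hG).1, fun i S hS => hR _ _ _ ((h3 q cs hG).2 i S hS)⟩,
    fun p q cs hG hp hq i S hS => hR _ _ _ (h4 p q cs hG hp hq i S hS)⟩

theorem Proj.fold {G : Gtt} {r : Prt} {T : Ltt} (h : ProjF Proj G r T) : Proj G r T :=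
  ⟨fun g r t => ProjF Proj g r t, fun _ _ _ h => h.mono fun _ _ _ h => h.unfold, h⟩

/-! ### Properties of projections -/

theorem Proj.endH_iff {G : Gtt} {r : Prt} {T : Ltt} (h : Proj G r T) :
    T.node [] = some .endH ↔ ¬ IsPart r G := by
  refine ⟨fun hT hp => ?_, h.unfold.1⟩
  induction hp with
  | here hG hr =>
    rcases hr with rfl | rfl
    · have := (h.unfold.2.2.1 _ _ hG).1
      simp [hT] at this
    · have := (h.unfold.2.1 _ _ hG).1
      simp [hT] at this
  | @there G p q cs i S hG hS _ ih =>
    by_cases hp : r = p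
    · subst hp
      have := (h.unfold.2.2.1 _ _ hG).1
      simp [hT] at this
    by_cases hq : r = q
    · subst hq
      have := (h.unfold.2.1 _ _ hG).1
      simp [hT] at this
    exact ih (h.unfold.2.2.2 _ _ _ hG hp hq _ _ hS)

theorem Proj.isPart_of_sendH {G : Gtt} {r q : Prt} {T : Ltt} {cs} (h : Proj G r T)
    (hT : T.node [] = some (.sendH q cs)) : IsPart r G := by
  by_contra hn
  have := h.endH_iff.2 hn
  simp [hT] at this

theorem Projectable.child {G : Gtt} {p q : Prt} {cs i S} (h : Projectable G)
    (hG : G.node [] = some (.commH p q cs)) (hS : cs[i]? = some (some S)) :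
    Projectable (G.child i) := by
  intro r
  obtain ⟨T, hT⟩ := h r
  by_cases hp : r = p
  · subst hp
    exact ⟨_, (hT.unfold.2.2.1 _ _ hG).2 i S hS⟩
  by_cases hq : r = q
  · subst hq
    exact ⟨_, (hT.unfold.2.1 _ _ hG).2 i S hS⟩
  exact ⟨T, hT.unfold.2.2.2 _ _ _ hG hp hq i S hS⟩

/-- At the root of a global type whose projections on `p` and `q` are a send from `p` to `q` and a
receive of `q` from `p`, either `p` communicates to `q`, or neither `p` nor `q` is involved. -/
theorem root_of_proj_send_recv {G : Gtt} {p q x y : Prt} {Tp Tq : Ltt} {cs cs₁ cs₂}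
    (hp : Proj G p Tp) (hq : Proj G q Tq) (hTp : Tp.node [] = some (.sendH q cs₁))
    (hTq : Tq.node [] = some (.recvH p cs₂)) (hG : G.node [] = some (.commH x y cs)) :
    (x = p ∧ y = q ∧ cs = cs₁ ∧ cs = cs₂) ∨ (p ≠ x ∧ p ≠ y ∧ q ≠ x ∧ q ≠ y) := by
  by_cases hpx : p = x
  · subst hpx
    have h1 := (hp.unfold.2.2.1 _ _ hG).1
    rw [hTp] at h1
    cases h1
    have h2 := (hq.unfold.2.1 _ _ hG).1
    rw [hTq] at h2
    cases h2
    exact .inl ⟨rfl, rfl, rfl, rfl⟩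
  by_cases hpy : p = y
  · subst hpy
    have h1 := (hp.unfold.2.1 _ _ hG).1
    simp [hTp] at h1
  by_cases hqx : q = x
  · subst hqx
    have h1 := (hq.unfold.2.2.1 _ _ hG).1
    simp [hTq] at h1
  by_cases hqy : q = y
  · subst hqy
    have h1 := (hq.unfold.2.1 _ _ hG).1
    rw [hTq] at h1
    cases h1
    exact absurd rfl hpx
  exact .inr ⟨hpx, hpy, hqx, hqy⟩

theorem labels_eq_of_proj_send_recv {G : Gtt} {p q : Prt} {Tp Tq : Ltt} {cs₁ cs₂}
    (hp : Proj G p Tp) (hq : Proj G q Tq) (hTp : Tp.node [] = some (.sendH q cs₁))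
    (hTq : Tq.node [] = some (.recvH p cs₂)) : cs₁ = cs₂ := by
  have hpart := hp.isPart_of_sendH hTp
  induction hpart with
  | here hG hr =>
    rcases root_of_proj_send_recv hp hq hTp hTq hG with ⟨_, _, h, h'⟩ | ⟨h, h', _⟩
    · exact h.symm.trans h'
    · exact absurd hr (by simp [h, h'])
  | there hG hS _ ih =>
    rcases root_of_proj_send_recv hp hq hTp hTq hG with ⟨_, _, h, h'⟩ | ⟨h1, h2, h3, h4⟩
    · exact h.symm.trans h'
    · exact ih (hp.unfold.2.2.2 _ _ _ hG h1 h2 _ _ hS) (hq.unfold.2.2.2 _ _ _ hG h3 h4 _ _ hS)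

/-! ### Balanced global type trees -/

theorem Subtree.eq_or_child {G H : Gtt} (h : Subtree G H) :
    H = G ∨ ∃ p q cs i S, G.node [] = some (.commH p q cs) ∧ cs[i]? = some (some S) ∧
      Subtree (G.child i) H := by
  induction h with
  | refl => exact .inl rfl
  | child _ hG hS ih =>
    rcases ih with rfl | ⟨p, q, cs, i, S, h1, h2, h3⟩
    · exact .inr ⟨_, _, _, _, _, hG, hS, .refl _⟩
    · exact .inr ⟨p, q, cs, i, S, h1, h2, h3.child hG hS⟩

theorem Subtree.trans {G H K : Gtt} (h : Subtree G H) (h' : Subtree H K) : Subtree G K := by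
  induction h' with
  | refl => exact h
  | child _ hG hS ih => exact ih.child hG hS

theorem BalancedG.child {G : Gtt} {p q : Prt} {cs i S} (h : BalancedG G)
    (hG : G.node [] = some (.commH p q cs)) (hS : cs[i]? = some (some S)) :
    BalancedG (G.child i) :=
  fun _ hH => h _ (((Subtree.refl G).child hG hS).trans hH)

theorem Occ.mono {r : Prt} {k k' : ℕ} {G : Gtt} (h : Occ r k G) (hk : k ≤ k') : Occ r k' G := by
  induction h generalizing k' with
  | here hG hr => exact .here hG hr
  | step hG _ ih =>
    obtain ⟨m, rfl⟩ : ∃ m, k' = m + 1 := ⟨k' - 1, by omega⟩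
    exact .step hG fun i S hS => ih i S hS (by omega)

theorem BalancedG.of_children {G : Gtt} {p q : Prt} {cs} (hproj : Projectable G)
    (hG : G.node [] = some (.commH p q cs))
    (h : ∀ i S, cs[i]? = some (some S) → BalancedG (G.child i)) : BalancedG G := by
  intro H hH
  rcases hH.eq_or_child with rfl | ⟨_, _, _, i, S, hG', hS, hsub⟩
  · have hbound : ∀ i, ∃ k, (∃ S, cs[i]? = some (some S)) →
        ∀ r, IsPart r (H.child i) → Occ r k (H.child i) := by
      intro i
      by_cases hi : ∃ S, cs[i]? = some (some S)
      · obtain ⟨S, hS⟩ := hi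
        obtain ⟨k, hk⟩ := h i S hS _ (.refl _)
        exact ⟨k, fun _ => hk⟩
      · exact ⟨0, fun h => absurd h hi⟩
    choose k hk using hbound
    refine ⟨(Finset.range cs.length).sup k + 1, fun r hr => ?_⟩
    by_cases hrpq : r = p ∨ r = q
    · exact .here hG hrpq
    push Not at hrpq
    refine .step hG fun i S hS => ?_
    obtain ⟨T, hT⟩ := hproj r
    have hTi := hT.unfold.2.2.2 _ _ _ hG hrpq.1 hrpq.2 i S hS
    have hri : IsPart r (H.child i) := by
      by_contra hn
      exact hT.endH_iff.1 (hTi.endH_iff.2 hn) hr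
    refine (hk i ⟨S, hS⟩ r hri).mono (Finset.le_sup (f := k) (Finset.mem_range.2 ?_))
    exact (List.getElem?_eq_some_iff.1 hS).1
  · rw [hG] at hG'
    cases hG'
    exact h i S hS H hsub

/-! ### Performing a communication inside a global type tree -/

theorem Proj.mkComm_of_notMem {x y r : Prt} {cs : List (Option Srt)} {f : ℕ → Gtt} {T : Ltt}
    (hrx : r ≠ x) (hry : r ≠ y) (hne : ∃ (i : ℕ) (S : Srt), cs[i]? = some (some S))
    (h : ∀ i S, cs[i]? = some (some S) → Proj (f i) r T) : Proj (Gtt.mkComm x y cs f) r T := by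
  have hroot := Gtt.mkComm_node_nil x y cs f
  refine Proj.fold ⟨fun hn => ?_, fun p c hc => ?_, fun q c hc => ?_, fun p q c hc _ _ i S hS => ?_⟩
  · obtain ⟨i, S, hS⟩ := hne
    refine (h i S hS).endH_iff.2 fun hp => hn (.there hroot hS ?_)
    rwa [Gtt.mkComm_child x y f hS]
  · rw [hroot] at hc
    cases hc
    exact absurd rfl hry
  · rw [hroot] at hc
    cases hc
    exact absurd rfl hrx
  · rw [hroot] at hc
    cases hc
    rw [Gtt.mkComm_child x y f hS]
    exact h i S hS

theorem Proj.mkComm_of_child {G : Gtt} {x y r : Prt} {cs : List (Option Srt)} {f : ℕ → Gtt}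
    {T : Ltt} (hG : G.node [] = some (.commH x y cs)) (hne : ∃ (i : ℕ) (S : Srt), cs[i]? = some (some S))
    (h : ∀ i S, cs[i]? = some (some S) → ∀ T, Proj (G.child i) r T → Proj (f i) r T)
    (hT : Proj G r T) : Proj (Gtt.mkComm x y cs f) r T := by
  have hroot := Gtt.mkComm_node_nil x y cs f
  by_cases hr : r = x ∨ r = y
  · refine Proj.fold ⟨fun hn => absurd (.here hroot hr) hn, fun p c hc => ?_, fun q c hc => ?_,
      fun p q c hc hp hq => ?_⟩
    · rw [hroot] at hc
      cases hc
      have h' := hT.unfold.2.1 _ _ hG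
      refine ⟨h'.1, fun i S hS => ?_⟩
      rw [Gtt.mkComm_child _ _ f hS]
      exact h i S hS _ (h'.2 i S hS)
    · rw [hroot] at hc
      cases hc
      have h' := hT.unfold.2.2.1 _ _ hG
      refine ⟨h'.1, fun i S hS => ?_⟩
      rw [Gtt.mkComm_child _ _ f hS]
      exact h i S hS _ (h'.2 i S hS)
    · rw [hroot] at hc
      cases hc
      exact absurd hr (by simp [hp, hq])
  · push Not at hr
    exact Proj.mkComm_of_notMem hr.1 hr.2 hne fun i S hS =>
      h i S hS T (hT.unfold.2.2.2 _ _ _ hG hr.1 hr.2 i S hS)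

/-- `G'` is a balanced global type tree obtained from `G` by performing a communication from `p` to
`q`, after which `p` and `q` continue as `Tp` and `Tq`, and everyone else as before. -/
structure CommResult (p q : Prt) (Tp Tq : Ltt) (G G' : Gtt) : Prop where
  balanced : BalancedG G'
  proj_left : Proj G' p Tp
  proj_right : Proj G' q Tq
  proj_other : ∀ r, r ≠ p → r ≠ q → ∀ T, Proj G r T → Proj G' r T

theorem CommResult.projectable {p q : Prt} {Tp Tq : Ltt} {G G' : Gtt}
    (h : CommResult p q Tp Tq G G') (hG : Projectable G) : Projectable G' := by
  intro r
  by_cases hp : r = p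
  · exact ⟨Tp, hp ▸ h.proj_left⟩
  by_cases hq : r = q
  · exact ⟨Tq, hq ▸ h.proj_right⟩
  obtain ⟨T, hT⟩ := hG r
  exact ⟨T, h.proj_other r hp hq T hT⟩

theorem commResult_of_root {G : Gtt} {p q : Prt} {Tp Tq : Ltt} {cs : List (Option Srt)}
    {k : ℕ} {S : Srt} (hbal : BalancedG G) (hp : Proj G p Tp) (hq : Proj G q Tq)
    (hG : G.node [] = some (.commH p q cs)) (hS : cs[k]? = some (some S)) :
    CommResult p q (Tp.child k) (Tq.child k) G (G.child k) where
  balanced := hbal.child hG hS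
  proj_left := (hp.unfold.2.2.1 _ _ hG).2 k S hS
  proj_right := (hq.unfold.2.1 _ _ hG).2 k S hS
  proj_other _ hrp hrq _ hT := hT.unfold.2.2.2 _ _ _ hG hrp hrq k S hS

theorem exists_commResult {G : Gtt} {p q : Prt} {Tp Tq : Ltt} {cs₁ cs₂ : List (Option Srt)}
    {k : ℕ} {S : Srt} (hbal : BalancedG G) (hproj : Projectable G)
    (hp : Proj G p Tp) (hq : Proj G q Tq) (hTp : Tp.node [] = some (.sendH q cs₁))
    (hTq : Tq.node [] = some (.recvH p cs₂)) (hS : cs₁[k]? = some (some S)) :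
    ∃ G', CommResult p q (Tp.child k) (Tq.child k) G G' := by
  obtain ⟨n, hn⟩ := hbal G (.refl G)
  have hocc := hn p (hp.isPart_of_sendH hTp)
  clear hn
  induction hocc with
  | here hG hr =>
    rcases root_of_proj_send_recv hp hq hTp hTq hG with ⟨rfl, rfl, rfl, _⟩ | ⟨h, h', _⟩
    · exact ⟨_, commResult_of_root hbal hp hq hG hS⟩
    · exact absurd hr (by simp [h, h'])
  | @step n G x y cs hG _ ih =>
    rcases root_of_proj_send_recv hp hq hTp hTq hG with ⟨rfl, rfl, rfl, _⟩ | ⟨hpx, hpy, hqx, hqy⟩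
    · exact ⟨_, commResult_of_root hbal hp hq hG hS⟩
    have hne : ∃ (i : ℕ) (S : Srt), cs[i]? = some (some S) := by
      cases hp.isPart_of_sendH hTp with
      | here hG' hr =>
        rw [hG] at hG'
        cases hG'
        exact absurd hr (by simp [hpx, hpy])
      | there hG' hi =>
        rw [hG] at hG'
        cases hG'
        exact ⟨_, _, hi⟩
    have hchild : ∀ i, ∃ G', ∀ S, cs[i]? = some (some S) →
        CommResult p q (Tp.child k) (Tq.child k) (G.child i) G' := by
      intro i
      by_cases hi : ∃ S, cs[i]? = some (some S)
      · obtain ⟨S, hi⟩ := hi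
        obtain ⟨G', hG'⟩ := ih i S hi (hbal.child hG hi) (hproj.child hG hi)
          (hp.unfold.2.2.2 _ _ _ hG hpx hpy i S hi) (hq.unfold.2.2.2 _ _ _ hG hqx hqy i S hi)
        exact ⟨G', fun _ _ => hG'⟩
      · exact ⟨G, fun S h => absurd ⟨S, h⟩ hi⟩
    choose f hf using hchild
    have hleft : Proj (Gtt.mkComm x y cs f) p (Tp.child k) :=
      Proj.mkComm_of_notMem hpx hpy hne fun i S hi => (hf i S hi).proj_left
    have hright : Proj (Gtt.mkComm x y cs f) q (Tq.child k) :=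
      Proj.mkComm_of_notMem hqx hqy hne fun i S hi => (hf i S hi).proj_right
    have hother : ∀ r, r ≠ p → r ≠ q → ∀ T, Proj G r T → Proj (Gtt.mkComm x y cs f) r T :=
      fun r hrp hrq T hT =>
        Proj.mkComm_of_child hG hne (fun i S hi => (hf i S hi).proj_other r hrp hrq) hT
    refine ⟨Gtt.mkComm x y cs f, ?_, hleft, hright, hother⟩
    have hproj' : Projectable (Gtt.mkComm x y cs f) := by
      intro r
      by_cases hrp : r = p
      · exact ⟨_, hrp ▸ hleft⟩
      by_cases hrq : r = q
      · exact ⟨_, hrq ▸ hright⟩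
      obtain ⟨T, hT⟩ := hproj r
      exact ⟨T, hother r hrp hrq T hT⟩
    refine BalancedG.of_children hproj' (Gtt.mkComm_node_nil x y cs f) fun i S hi => ?_
    rw [Gtt.mkComm_child x y f hi]
    exact (hf i S hi).balanced

/-! ### Environment transitions -/

theorem Env.upd_comm {Γ : Env} {p q : Prt} (h : p ≠ q) (T T' : Ltt) :
    (Γ.upd p T).upd q T' = (Γ.upd q T').upd p T := by
  funext r
  simp only [Env.upd]
  grind

theorem Env.single_upd (p : Prt) (T T' : Ltt) : (Env.single p T).upd p T' = Env.single p T' := by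
  funext r
  simp only [Env.upd, Env.single]
  grind

theorem Env.finite_upd {Γ : Env} (h : EnvFin Γ) (p : Prt) (T : Ltt) : EnvFin (Γ.upd p T) := by
  refine (h.insert p).subset fun r hr => ?_
  simp only [Set.mem_ofPred_eq, Env.upd, Set.mem_insert_iff] at hr ⊢
  grind

theorem EStep.sendL_inv {Γ Γ' : Env} {p q : Prt} {S : Srt} {k : ℕ}
    (h : EStep Γ (.sendL p q S k) Γ') :
    ∃ T cs, Γ p = some T ∧ T.node [] = some (.sendH q cs) ∧ cs[k]? = some (some S) ∧
      Γ' = Γ.upd p (T.child k) := by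
  generalize hα : TLabel.sendL p q S k = α at h
  induction h with
  | recv => cases hα
  | comm => cases hα
  | send hT hS =>
    cases hα
    exact ⟨_, _, by simp [Env.single], hT, hS, (Env.single_upd _ _ _).symm⟩
  | @ext Γ Γ' α r U _ hr ih =>
    obtain ⟨T, cs, h1, h2, h3, rfl⟩ := ih hα
    have hne : p ≠ r := by
      rintro rfl
      simp [hr] at h1
    exact ⟨T, cs, by simp [Env.upd, hne, h1], h2, h3, Env.upd_comm hne _ _⟩

theorem EStep.recvL_inv {Γ Γ' : Env} {p q : Prt} {S : Srt} {k : ℕ}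
    (h : EStep Γ (.recvL p q S k) Γ') :
    ∃ T cs, Γ p = some T ∧ T.node [] = some (.recvH q cs) ∧ cs[k]? = some (some S) ∧
      Γ' = Γ.upd p (T.child k) := by
  generalize hα : TLabel.recvL p q S k = α at h
  induction h with
  | send => cases hα
  | comm => cases hα
  | recv hT hS =>
    cases hα
    exact ⟨_, _, by simp [Env.single], hT, hS, (Env.single_upd _ _ _).symm⟩
  | @ext Γ Γ' α r U _ hr ih =>
    obtain ⟨T, cs, h1, h2, h3, rfl⟩ := ih hα
    have hne : p ≠ r := by
      rintro rfl
      simp [hr] at h1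
    exact ⟨T, cs, by simp [Env.upd, hne, h1], h2, h3, Env.upd_comm hne _ _⟩

theorem EStep.commL_inv {Γ Γ' : Env} {p q : Prt} {k : ℕ} (h : EStep Γ (.commL p q k) Γ') :
    ∃ T T' cs cs' S, p ≠ q ∧ Γ p = some T ∧ Γ q = some T' ∧ T.node [] = some (.sendH q cs) ∧
      T'.node [] = some (.recvH p cs') ∧ cs[k]? = some (some S) ∧
      Γ' = (Γ.upd p (T.child k)).upd q (T'.child k) := by
  generalize hα : TLabel.commL p q k = α at h
  induction h with
  | send => cases hα
  | recv => cases hα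
  | @comm Γ₁ Γ₁' Γ₂ Γ₂' p' q' S S' k' hs hr _ hdisj =>
    cases hα
    obtain ⟨T, cs, h1, h2, h3, rfl⟩ := hs.sendL_inv
    obtain ⟨T', cs', h1', h2', h3', rfl⟩ := hr.recvL_inv
    have hq : Γ₁ q = none := by
      rcases hdisj q with h | h
      · exact h
      · simp [h1'] at h
    have hne : p ≠ q := by
      rintro rfl
      simp [h1] at hq
    refine ⟨T, T', cs, cs', S, hne, by simp [Env.union, h1], by simp [Env.union, hq, h1'], h2, h2',
      h3, ?_⟩
    funext r
    by_cases hrq : r = q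
    · subst hrq
      simp [Env.union, Env.upd, hq, hne.symm]
    · by_cases hrp : r = p <;> simp [Env.union, Env.upd, hrq, hrp, hne]
  | @ext Γ Γ' α r U _ hr ih =>
    obtain ⟨T, T', cs, cs', S, hne, h1, h1', h2, h2', h3, rfl⟩ := ih hα
    have hp : p ≠ r := by
      rintro rfl
      simp [hr] at h1
    have hq : q ≠ r := by
      rintro rfl
      simp [hr] at h1'
    refine ⟨T, T', cs, cs', S, hne, by simp [Env.upd, hp, h1], by simp [Env.upd, hq, h1'], h2, h2',
      h3, ?_⟩
    rw [Env.upd_comm hq, Env.upd_comm hp]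

/-- A transition of a part of a finite environment is a transition of the whole environment. -/
theorem CanE.extend {Δ Γ : Env} {α : TLabel} (h : CanE Δ α) (hfin : EnvFin Γ)
    (hsub : ∀ r, Δ r = none ∨ Γ r = Δ r) : CanE Γ α := by
  have key : ∀ (s : Finset Prt) (Γ : Env), (∀ r ∉ s, Γ r = Δ r) →
      (∀ r, Δ r = none ∨ Γ r = Δ r) → CanE Γ α := by
    intro s
    induction s using Finset.induction_on with
    | empty =>
      intro Γ hΓ _
      rwa [show Γ = Δ from funext fun r => hΓ r (by simp)]
    | insert a s _ ih =>
      intro Γ hΓ hsub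
      by_cases ha : Γ a = Δ a
      · refine ih Γ (fun r hr => ?_) hsub
        by_cases hra : r = a
        · rw [hra, ha]
        · exact hΓ r (by simp [hra, hr])
      · have hΔ : Δ a = none := (hsub a).resolve_right ha
        obtain ⟨T, hT⟩ := Option.ne_none_iff_exists'.1 (hΔ ▸ ha)
        obtain ⟨Γ', hstep⟩ := ih (fun r => if r = a then none else Γ r)
          (fun r hr => by
            by_cases hra : r = a
            · simp [hra, hΔ]
            · simpa [hra] using hΓ r (by simp [hra, hr]))
          (fun r => by
            by_cases hra : r = a
            · simp [hra, hΔ]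
            · simpa [hra] using hsub r)
        have := hstep.ext (p := a) (T := T) (by simp)
        refine ⟨_, (?_ : Env.upd _ a T = Γ) ▸ this⟩
        funext r
        by_cases hra : r = a <;> simp [Env.upd, hra, hT]
  refine key hfin.toFinset Γ (fun r hr => ?_) hsub
  have hr' : Γ r = none := by
    by_contra hn
    exact hr (hfin.mem_toFinset.2 hn)
  rcases hsub r with h | h
  · rw [h, hr']
  · exact h

theorem CanE.commL {Γ : Env} {p q : Prt} {T T' : Ltt} {cs cs' : List (Option Srt)} {k : ℕ}
    {S S' : Srt} (hfin : EnvFin Γ) (hp : Γ p = some T) (hq : Γ q = some T')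
    (hT : T.node [] = some (.sendH q cs)) (hT' : T'.node [] = some (.recvH p cs'))
    (hS : cs[k]? = some (some S)) (hS' : cs'[k]? = some (some S')) (hsub : Subsort S S') :
    CanE Γ (.commL p q k) := by
  have hne : q ≠ p := by
    rintro rfl
    rw [hp] at hq
    cases hq
    simp [hT] at hT'
  refine CanE.extend ⟨_, .comm (.send (p := p) hT hS) (.recv (p := q) hT' hS') hsub ?_⟩ hfin ?_
  · intro r
    by_cases hr : r = p
    · exact .inr (by simp [Env.single, hr, hne.symm])
    · exact .inl (by simp [Env.single, hr])
  · intro r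
    by_cases hrp : r = p
    · exact .inr (by simp [Env.union, Env.single, hrp, hp])
    · by_cases hrq : r = q
      · exact .inr (by simp [Env.union, Env.single, hrq, hq, hne])
      · exact .inl (by simp [Env.union, Env.single, hrp, hrq])

/-! ### Association -/

theorem Assoc.proj {Γ : Env} {G : Gtt} (h : Assoc Γ G) {p : Prt} {T : Ltt} (hp : Γ p = some T)
    (hT : T.node [] ≠ some .endH) : ∃ Tp, Proj G p Tp ∧ SubT T Tp := by
  by_cases hpart : IsPart p G
  · obtain ⟨U, Tp, hU, hproj, hsub⟩ := h.1 p hpart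
    rw [hp] at hU
    cases hU
    exact ⟨Tp, hproj, hsub⟩
  · rcases h.2 p hpart with h | ⟨U, hU, hend⟩
    · simp [hp] at h
    · rw [hp] at hU
      cases hU
      exact absurd hend hT

/-- The projections behind an associated sender and receiver carry the same labels. -/
theorem Assoc.proj_send_recv {Γ : Env} {G : Gtt} (h : Assoc Γ G) {p q : Prt} {T T' : Ltt} {cs cs'}
    (hp : Γ p = some T) (hq : Γ q = some T') (hT : T.node [] = some (.sendH q cs))
    (hT' : T'.node [] = some (.recvH p cs')) :
    ∃ Tp Tq ds, Proj G p Tp ∧ Proj G q Tq ∧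
      Tp.node [] = some (.sendH q ds) ∧ Tq.node [] = some (.recvH p ds) ∧
      ∀ (k : ℕ) S, cs[k]? = some (some S) → ∃ S₁ S', ds[k]? = some (some S₁) ∧
        cs'[k]? = some (some S') ∧ Subsort S S' ∧
        SubT (T.child k) (Tp.child k) ∧ SubT (T'.child k) (Tq.child k) := by
  obtain ⟨Tp, hTp, hsub⟩ := h.proj hp (by simp [hT])
  obtain ⟨Tq, hTq, hsub'⟩ := h.proj hq (by simp [hT'])
  obtain ⟨c, hc, H⟩ := hsub.of_sendH hT
  obtain ⟨c', hc', H'⟩ := hsub'.of_recvH hT'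
  obtain rfl := labels_eq_of_proj_send_recv hTp hTq hc hc'
  refine ⟨Tp, Tq, c, hTp, hTq, hc, hc', fun k S hS => ?_⟩
  obtain ⟨S₁, h1, h2, h3⟩ := H k S hS
  obtain ⟨S', h1', h2', h3'⟩ := H' k S₁ h1
  exact ⟨S₁, S', h1, h1', h2.trans h2', h3, h3'⟩

theorem Assoc.commResult {Γ : Env} {G G' : Gtt} {p q : Prt} {T T' Tp Tq : Ltt}
    (h : Assoc Γ G) (hproj : Projectable G) (hne : p ≠ q) (hG' : CommResult p q Tp Tq G G')
    (hT : SubT T Tp) (hT' : SubT T' Tq) : Assoc ((Γ.upd p T).upd q T') G' := by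
  have hother : ∀ r, r ≠ p → r ≠ q → (IsPart r G ↔ IsPart r G') := by
    intro r hrp hrq
    obtain ⟨U, hU⟩ := hproj r
    exact not_iff_not.1 (hU.endH_iff.symm.trans (hG'.proj_other r hrp hrq U hU).endH_iff)
  have hΓp : ((Γ.upd p T).upd q T') p = some T := by simp [Env.upd, hne]
  have hΓq : ((Γ.upd p T).upd q T') q = some T' := by simp [Env.upd]
  have hΓ : ∀ r, r ≠ p → r ≠ q → ((Γ.upd p T).upd q T') r = Γ r := by
    intro r hrp hrq
    simp [Env.upd, hrp, hrq]
  refine ⟨fun r hr => ?_, fun r hr => ?_⟩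
  · by_cases hrp : r = p
    · subst hrp
      exact ⟨T, Tp, hΓp, hG'.proj_left, hT⟩
    by_cases hrq : r = q
    · subst hrq
      exact ⟨T', Tq, hΓq, hG'.proj_right, hT'⟩
    obtain ⟨U, Ur, h1, h2, h3⟩ := h.1 r ((hother r hrp hrq).2 hr)
    exact ⟨U, Ur, (hΓ r hrp hrq).trans h1, hG'.proj_other r hrp hrq Ur h2, h3⟩
  · by_cases hrp : r = p
    · subst hrp
      exact .inr ⟨T, hΓp, hT.endH (hG'.proj_left.endH_iff.2 hr)⟩
    by_cases hrq : r = q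
    · subst hrq
      exact .inr ⟨T', hΓq, hT'.endH (hG'.proj_right.endH_iff.2 hr)⟩
    rw [hΓ r hrp hrq]
    exact h.2 r fun hr' => hr ((hother r hrp hrq).1 hr')

/-- **Safety by Association.** If `G` is a balanced, projectable global type tree and
`Γ ⊨ G` (`Γ` a finite map), then `Γ ∈ safe`. -/
theorem safety_by_association (G : Gtt) (Γ : Env)
    (hbal : BalancedG G) (hproj : Projectable G) (hfin : EnvFin Γ)
    (hassoc : Assoc Γ G) :
    Safe Γ := by
  refine ⟨fun Γ => EnvFin Γ ∧ ∃ G, BalancedG G ∧ Projectable G ∧ Assoc Γ G, ?_,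
    hfin, G, hbal, hproj, hassoc⟩
  rintro Γ ⟨hfin, G, hbal, hproj, hassoc⟩
  refine ⟨?_, ?_⟩
  · rintro p q S S' k k' ⟨_, hsend⟩ ⟨_, hrecv⟩
    obtain ⟨T, cs, hp, hT, hS, -⟩ := hsend.sendL_inv
    obtain ⟨T', cs', hq, hT', -, -⟩ := hrecv.recvL_inv
    obtain ⟨_, _, _, _, _, _, _, H⟩ := hassoc.proj_send_recv hp hq hT hT'
    obtain ⟨_, S₂, _, hS₂, hsub, _⟩ := H k S hS
    exact CanE.commL hfin hp hq hT hT' hS hS₂ hsub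
  · intro p q k Γ' hstep
    obtain ⟨T, T', cs, cs', S, hne, hp, hq, hT, hT', hS, rfl⟩ := hstep.commL_inv
    obtain ⟨Tp, Tq, c, hTp, hTq, hc, hc', H⟩ := hassoc.proj_send_recv hp hq hT hT'
    obtain ⟨S₁, _, hS₁, _, _, hsub, hsub'⟩ := H k S hS
    obtain ⟨G', hG'⟩ := exists_commResult hbal hproj hTp hTq hc hc' hS₁
    exact ⟨Env.finite_upd (Env.finite_upd hfin _ _) _ _, G', hG'.balanced,
      hG'.projectable hproj, hassoc.commResult hproj hne hG' hsub hsub'⟩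
end

section
/- (Liveness of the projection environment) Let G be a balanced, projectable global type tree and let Γ_proj = { p : G↾p | p ∈ parts(G) } be the local type environment mapping each participant of G to its projection. Then Γ_proj is a live environment. -/
set_option maxHeartbeats 1000000

/-- The participants `p` and `q`, with local types `T` and `U`, are ready to exchange `l`. -/
def CommReady (p q : Prt) (l : ℕ) (T U : Ltt) : Prop :=
  p ≠ q ∧ ∃ cs cs' S S', T.node [] = some (.sendH q cs) ∧ cs[l]? = some (some S) ∧
    U.node [] = some (.recvH p cs') ∧ cs'[l]? = some (some S') ∧ Subsort S S'

theorem EStep.commL_inv_s5 {Γ Γ' : Env} {p q : Prt} {l : ℕ} (h : EStep Γ (.commL p q l) Γ') :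
    ∃ T U, Γ p = some T ∧ Γ q = some U ∧ CommReady p q l T U ∧
      Γ' p = some (T.child l) ∧ Γ' q = some (U.child l) ∧
      ∀ r, r ≠ p → r ≠ q → Γ' r = Γ r := by
  generalize hα : TLabel.commL p q l = α at h
  induction h with
  | send => cases hα
  | recv => cases hα
  | @ext Γ Γ' α r V _ hr ih =>
    obtain ⟨T, U, hT, hU, hc, hT', hU', hother⟩ := ih hα
    have hpr : p ≠ r := by rintro rfl; simp [hr] at hT
    have hqr : q ≠ r := by rintro rfl; simp [hr] at hU
    refine ⟨T, U, by simp [Env.upd, hpr, hT], by simp [Env.upd, hqr, hU], hc,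
      by simp [Env.upd, hpr, hT'], by simp [Env.upd, hqr, hU'], fun x hxp hxq => ?_⟩
    by_cases hx : x = r <;> simp [Env.upd, hx]
    exact hother x hxp hxq
  | @comm Γ₁ Γ₁' Γ₂ Γ₂' p' q' S S' k h₁ h₂ hS hdisj =>
    cases hα
    obtain ⟨T, cs, hT, hTn, hTc, rfl⟩ := h₁.sendL_inv
    obtain ⟨U, cs', hU, hUn, hUc, rfl⟩ := h₂.recvL_inv
    have hq₁ : Γ₁ q = none := (hdisj q).resolve_right (by simp [hU])
    have hpq : p ≠ q := by rintro rfl; simp [hq₁] at hT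
    refine ⟨T, U, by simp [Env.union, hT], by simp [Env.union, hq₁, hU],
      ⟨hpq, cs, cs', S, S', hTn, hTc, hUn, hUc, hS⟩, by simp [Env.union, Env.upd],
      by simp [Env.union, Env.upd, hpq.symm, hq₁], fun r hrp hrq => ?_⟩
    simp [Env.union, Env.upd, hrp, hrq]

/-- A transition is preserved by adding finitely many participants. -/
theorem EStep.extend {Γ Γ' : Env} {α : TLabel} (h : EStep Γ α Γ') (Δ : Env) (s : Finset Prt)
    (hs : ∀ r ∈ s, Γ r = none) : CanE (fun r => if r ∈ s then Δ r else Γ r) α := by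
  induction s using Finset.induction_on with
  | empty => exact ⟨Γ', by simpa using h⟩
  | insert a s ha ih =>
    obtain ⟨Γ'', h''⟩ := ih fun r hr => hs r (Finset.mem_insert_of_mem hr)
    have hΓa := hs a (Finset.mem_insert_self a s)
    cases hΔ : Δ a with
    | none =>
      refine ⟨Γ'', ?_⟩
      convert h'' using 2 with r
      by_cases hr : r = a
      · subst hr; simp [ha, hΔ, hΓa]
      · simp [hr]
    | some T =>
      refine ⟨Γ''.upd a T, ?_⟩
      convert EStep.ext (p := a) (T := T) h'' (by simp [ha, hΓa]) using 1
      funext r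
      by_cases hr : r = a
      · subst hr; simp [Env.upd, hΔ]
      · simp [Env.upd, hr]

theorem CommReady.canE {Γ : Env} {p q : Prt} {l : ℕ} {T U : Ltt} (h : CommReady p q l T U)
    (hΓ : EnvFin Γ) (hT : Γ p = some T) (hU : Γ q = some U) : CanE Γ (.commL p q l) := by
  obtain ⟨hpq, cs, cs', S, S', hTn, hTc, hUn, hUc, hS⟩ := h
  have hcomm := EStep.comm (EStep.send (p := p) hTn hTc) (EStep.recv (p := q) hUn hUc) hS (by
    intro r
    by_cases hr : r = p
    · subst hr; simp [Env.single, hpq]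
    · simp [Env.single, hr])
  have hext := hcomm.extend Γ ((hΓ.toFinset.erase p).erase q) (by
    intro r hr
    simp only [Finset.mem_erase] at hr
    simp [Env.union, Env.single, hr.1, hr.2.1])
  convert hext using 1
  funext r
  by_cases hrq : r = q
  · subst hrq; simp [Env.union, Env.single, hpq.symm, hU]
  by_cases hrp : r = p
  · subst hrp; simp [Env.union, Env.single, hT]
  have hmem : r ∈ hΓ.toFinset ↔ Γ r ≠ none := hΓ.mem_toFinset
  by_cases hr : Γ r = none <;> simp [hrp, hrq, hr, hmem, Env.union, Env.single]

theorem EStep.envFin {Γ Γ' : Env} {p q : Prt} {l : ℕ} (h : EStep Γ (.commL p q l) Γ')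
    (hΓ : EnvFin Γ) : EnvFin Γ' := by
  obtain ⟨T, U, hT, hU, -, -, -, hother⟩ := h.commL_inv_s5
  refine hΓ.subset fun r hr => ?_
  by_cases hrp : r = p
  · subst hrp; simp [hT]
  by_cases hrq : r = q
  · subst hrq; simp [hU]
  simpa [hother r hrp hrq] using hr

/-- Distinct enabled communications concern disjoint pairs of participants. -/
theorem EStep.commL_diamond {Γ Γ' : Env} {p q a b : Prt} {l k : ℕ}
    (h : EStep Γ (.commL a b k) Γ') (hΓ : EnvFin Γ) (hc : CanE Γ (.commL p q l)) :
    (p = a ∧ q = b) ∨ CanE Γ' (.commL p q l) := by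
  obtain ⟨T, U, hT, hU, hr, -, -, hother⟩ := h.commL_inv_s5
  obtain ⟨_, hc⟩ := hc
  obtain ⟨T', U', hT', hU', hr', -⟩ := hc.commL_inv_s5
  obtain ⟨hab, cs, ds, S, R, hTn, -, hUn, -⟩ := id hr
  obtain ⟨hpq, cs', ds', S', R', hTn', -, hUn', -⟩ := id hr'
  by_cases hpa : p = a
  · subst hpa
    rw [hT] at hT'; cases hT'
    rw [hTn] at hTn'; cases hTn'
    exact .inl ⟨rfl, rfl⟩
  by_cases hqb : q = b
  · subst hqb
    rw [hU] at hU'; cases hU'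
    rw [hUn] at hUn'; cases hUn'
    exact .inl ⟨rfl, rfl⟩
  have hpb : p ≠ b := by
    rintro rfl
    rw [hU] at hT'; cases hT'
    rw [hUn] at hTn'; cases hTn'
  have hqa : q ≠ a := by
    rintro rfl
    rw [hT] at hU'; cases hU'
    rw [hTn] at hUn'; cases hUn'
  rw [← hother p hpa hpb] at hT'
  rw [← hother q hqa hqb] at hU'
  right
  apply hr'.canE (h.envFin hΓ) <;> assumption

/-! ## Prefixing reduction paths -/

/-- The path that performs the communication `a` from `Γ` to `ρ.st 0` and then follows `ρ`. -/
def EnvPath.cons (Γ : Env) (a : Prt × Prt × ℕ) (ρ : EnvPath)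
    (h : EStep Γ (.commL a.1 a.2.1 a.2.2) (ρ.st 0)) : EnvPath where
  st n := match n with
    | 0 => Γ
    | n + 1 => ρ.st n
  lb n := match n with
    | 0 => a
    | n + 1 => ρ.lb n
  alive n := match n with
    | 0 => True
    | n + 1 => ρ.alive n
  down n hn := match n, hn with
    | 0, _ => trivial
    | n + 1, hn => ρ.down n hn
  step n hn := match n, hn with
    | 0, _ => h
    | n + 1, hn => ρ.step n hn

theorem EnvPath.valid_of_alive (ρ : EnvPath) {n : ℕ} (h : ρ.alive n) : ρ.valid n := by
  cases n with
  | zero => trivial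
  | succ n => exact ρ.down n h

theorem EnvPath.valid_cons_succ {Γ : Env} {a : Prt × Prt × ℕ} {ρ : EnvPath}
    {h : EStep Γ (.commL a.1 a.2.1 a.2.2) (ρ.st 0)} {n : ℕ} :
    (ρ.cons Γ a h).valid (n + 1) ↔ ρ.valid n := by
  cases n <;> simp [EnvPath.valid, EnvPath.cons]

theorem FairEPath.cons {Γ : Env} {a : Prt × Prt × ℕ} {ρ : EnvPath} (hρ : FairEPath ρ)
    (hΓ : EnvFin Γ) (h : EStep Γ (.commL a.1 a.2.1 a.2.2) (ρ.st 0)) :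
    FairEPath (ρ.cons Γ a h) := by
  have lift : ∀ n p q, ρ.valid n → (∃ l, CanE (ρ.st n) (.commL p q l)) →
      ∃ m, n + 1 ≤ m ∧ (ρ.cons Γ a h).alive m ∧ ∃ l', (ρ.cons Γ a h).lb m = (p, q, l') := by
    intro n p q hn hc
    obtain ⟨m, hm, ha, hl⟩ := hρ n p q hn hc
    exact ⟨m + 1, by omega, ha, hl⟩
  intro n p q hn ⟨l, hc⟩
  cases n with
  | zero =>
    rcases h.commL_diamond hΓ hc with ⟨rfl, rfl⟩ | hc'
    · exact ⟨0, le_rfl, trivial, a.2.2, rfl⟩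
    · obtain ⟨m, -, hm⟩ := lift 0 p q trivial ⟨l, hc'⟩
      exact ⟨m, Nat.zero_le m, hm⟩
  | succ n => exact lift n p q (EnvPath.valid_cons_succ.1 hn) ⟨l, hc⟩

theorem LiveEPath.of_cons {Γ : Env} {a : Prt × Prt × ℕ} {ρ : EnvPath}
    {h : EStep Γ (.commL a.1 a.2.1 a.2.2) (ρ.st 0)} (hl : LiveEPath (ρ.cons Γ a h)) :
    LiveEPath ρ := by
  have lower : ∀ n p q, (∃ m, n + 1 ≤ m ∧ (ρ.cons Γ a h).alive m ∧
      ∃ l', (ρ.cons Γ a h).lb m = (p, q, l')) →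
      ∃ m, n ≤ m ∧ ρ.alive m ∧ ∃ l', ρ.lb m = (p, q, l') := by
    rintro n p q ⟨_ | m, hm, ha, hl⟩
    · omega
    · exact ⟨m, by omega, ha, hl⟩
  intro n hn
  obtain ⟨hs, hr⟩ := hl (n + 1) (EnvPath.valid_cons_succ.2 hn)
  exact ⟨fun p q S l hc => lower n p q (hs p q S l hc),
    fun p q S l hc => lower n p q (hr p q S l hc)⟩

/-- For finite environments it suffices to consider fair paths from the initial environment. -/
theorem liveEnv_of_fair_paths {Γ : Env} (hΓ : EnvFin Γ)
    (h : ∀ ρ : EnvPath, ρ.st 0 = Γ → FairEPath ρ → LiveEPath ρ) : LiveEnv Γ := by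
  intro Γ' hred
  suffices EnvFin Γ' ∧ ∀ ρ : EnvPath, ρ.st 0 = Γ' → FairEPath ρ → LiveEPath ρ from this.2
  induction hred with
  | refl => exact ⟨hΓ, h⟩
  | tail _ hstep ih =>
    obtain ⟨p, q, l, hstep⟩ := hstep
    refine ⟨hstep.envFin ih.1, ?_⟩
    rintro ρ rfl hfair
    exact LiveEPath.of_cons (ih.2 (ρ.cons _ (p, q, l) hstep) rfl (hfair.cons ih.1 hstep))

/-! ## Participants along a reduction path -/

namespace EnvPath

variable {ρ : EnvPath}

theorem valid_mono {m n : ℕ} (hmn : m ≤ n) (hn : ρ.valid n) : ρ.valid m := by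
  induction n, hmn using Nat.le_induction with
  | base => exact hn
  | succ n _ ih => exact ih (ρ.valid_of_alive hn)

theorem alive_of_lt {m n : ℕ} (hmn : m < n) (hn : ρ.valid n) : ρ.alive m :=
  valid_mono (m := m + 1) hmn hn

theorem envFin_st (h : EnvFin (ρ.st 0)) : ∀ {n : ℕ}, ρ.valid n → EnvFin (ρ.st n)
  | 0, _ => h
  | n + 1, hn => (ρ.step n hn).envFin (envFin_st h (ρ.valid_of_alive hn))

/-- `p` takes part in the communication of index `s`. -/
def Acts (ρ : EnvPath) (p : Prt) (s : ℕ) : Prop := p = (ρ.lb s).1 ∨ p = (ρ.lb s).2.1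

/-- `p` has an available branch in the state of index `n`. -/
def Active (ρ : EnvPath) (p : Prt) (n : ℕ) : Prop :=
  ∃ T h i, ρ.st n p = some T ∧ T.node [] = some h ∧ h.branch i

theorem st_succ {p : Prt} {n : ℕ} (hn : ρ.alive n) (hp : ¬ ρ.Acts p n) :
    ρ.st (n + 1) p = ρ.st n p := by
  obtain ⟨-, -, -, -, -, -, -, hother⟩ := (ρ.step n hn).commL_inv_s5
  exact hother p (fun h => hp (.inl h)) (fun h => hp (.inr h))

theorem st_eq_of_idle {p : Prt} {m n : ℕ} (hmn : m ≤ n) (hn : ρ.valid n)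
    (h : ∀ s, m ≤ s → s < n → ¬ ρ.Acts p s) : ρ.st n p = ρ.st m p := by
  induction n, hmn using Nat.le_induction with
  | base => rfl
  | succ n hmn ih =>
    rw [st_succ hn (h n hmn n.lt_succ_self)]
    exact ih (ρ.valid_of_alive hn) fun s h₁ h₂ => h s h₁ (by omega)

theorem Acts.active {p : Prt} {n : ℕ} (hp : ρ.Acts p n) (hn : ρ.alive n) : ρ.Active p n := by
  obtain ⟨T, U, hT, hU, ⟨-, cs, cs', S, S', hTn, hTc, hUn, hUc, -⟩, -⟩ := (ρ.step n hn).commL_inv_s5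
  rcases hp with rfl | rfl
  · exact ⟨T, _, _, hT, hTn, S, hTc⟩
  · exact ⟨U, _, _, hU, hUn, S', hUc⟩

theorem Active.of_le {p : Prt} {m n : ℕ} (h : ρ.Active p n) (hmn : m ≤ n) (hn : ρ.valid n) :
    ρ.Active p m := by
  induction n, hmn using Nat.le_induction with
  | base => exact h
  | succ n _ ih =>
    refine ih ?_ (ρ.valid_of_alive hn)
    by_cases hp : ρ.Acts p n
    · exact hp.active hn
    · obtain ⟨T, hd, i, hT, hrest⟩ := h
      exact ⟨T, hd, i, by rw [← st_succ hn hp, hT], hrest⟩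

theorem Acts.lb_of_sendH {p q : Prt} {n : ℕ} {T : Ltt} {cs : List (Option Srt)}
    (hp : ρ.Acts p n) (hn : ρ.alive n) (hT : ρ.st n p = some T)
    (hh : T.node [] = some (.sendH q cs)) : ∃ l, ρ.lb n = (p, q, l) := by
  obtain ⟨A, B, hA, hB, ⟨-, _, _, _, _, hAn, -, hBn, -⟩, -⟩ := (ρ.step n hn).commL_inv_s5
  rcases hp with rfl | rfl
  · rw [hT] at hA; cases hA
    rw [hh] at hAn; cases hAn
    exact ⟨_, rfl⟩
  · rw [hT] at hB; cases hB
    rw [hh] at hBn; cases hBn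

theorem Acts.lb_of_recvH {p q : Prt} {n : ℕ} {T : Ltt} {cs : List (Option Srt)}
    (hp : ρ.Acts q n) (hn : ρ.alive n) (hT : ρ.st n q = some T)
    (hh : T.node [] = some (.recvH p cs)) : ∃ l, ρ.lb n = (p, q, l) := by
  obtain ⟨A, B, hA, hB, ⟨-, _, _, _, _, hAn, -, hBn, -⟩, -⟩ := (ρ.step n hn).commL_inv_s5
  rcases hp with rfl | rfl
  · rw [hT] at hA; cases hA
    rw [hh] at hAn; cases hAn
  · rw [hT] at hB; cases hB
    rw [hh] at hBn; cases hBn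
    exact ⟨_, rfl⟩

/-- A participant that can only act in communications `(a,b)` stays idle as long as
none of these occurs. -/
theorem idle_of_no_comm {p a b : Prt} {m n : ℕ} {T : Ltt} (hT : ρ.st m p = some T)
    (hab : ∀ s, ρ.alive s → ρ.st s p = some T → ρ.Acts p s → ∃ l, ρ.lb s = (a, b, l))
    (hn : ρ.valid n) (h : ∀ s, m ≤ s → s < n → ¬ ∃ l, ρ.lb s = (a, b, l)) :
    ∀ s, m ≤ s → s < n → ¬ ρ.Acts p s := by
  intro s
  induction s using Nat.strong_induction_on with
  | _ s ih =>
    intro hms hsn hact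
    have hs := alive_of_lt hsn hn
    refine h s hms hsn (hab s hs ?_ hact)
    rw [st_eq_of_idle hms (ρ.valid_of_alive hs) fun r h₁ h₂ => ih r h₂ h₁ (h₂.trans hsn), hT]

end EnvPath

/-- The path `ρ` has realised the part of a global type above its subtree `G`, where the
participant `p` has reached `G` in the state of index `t p`. -/
structure Reaches (ρ : EnvPath) (t : Prt → ℕ) (G : Gtt) : Prop where
  valid : ∀ p, ρ.valid (t p)
  sync : ∀ s, s < t (ρ.lb s).1 ↔ s < t (ρ.lb s).2.1
  proj : ∀ p T, ρ.st (t p) p = some T → Proj G p T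
  dom : ∀ p, IsPart p G → ρ.st (t p) p ≠ none

/-- On a fair path, the communication at the root of the current subtree is eventually
performed, and it is the next action of both of its participants. -/
theorem Reaches.exists_next {ρ : EnvPath} {t : Prt → ℕ} {G : Gtt} {a b : Prt}
    {cs : List (Option Srt)} {i : ℕ} {S : Srt} (h : Reaches ρ t G) (hfair : FairEPath ρ)
    (hfin : EnvFin (ρ.st 0)) (hG : G.node [] = some (.commH a b cs))
    (hi : cs[i]? = some (some S)) :
    ∃ m k S', cs[k]? = some (some S') ∧ t a ≤ m ∧ t b ≤ m ∧ ρ.alive m ∧ ρ.lb m = (a, b, k) ∧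
      (∀ s, t a ≤ s → s < m → ¬ ρ.Acts a s) ∧ (∀ s, t b ≤ s → s < m → ¬ ρ.Acts b s) ∧
      Reaches ρ (Function.update (Function.update t a (m + 1)) b (m + 1)) (G.child k) := by
  classical
  obtain ⟨A, hA⟩ := Option.ne_none_iff_exists'.1 (h.dom a (.here hG (.inl rfl)))
  obtain ⟨B, hB⟩ := Option.ne_none_iff_exists'.1 (h.dom b (.here hG (.inr rfl)))
  obtain ⟨hAn, hAc⟩ := (h.proj a A hA).unfold.2.2.1 b cs hG
  obtain ⟨hBn, hBc⟩ := (h.proj b B hB).unfold.2.1 a cs hG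
  have hab : a ≠ b := by
    rintro rfl
    rw [hA] at hB; cases hB
    rw [hAn] at hBn; cases hBn
  have idle : ∀ n, t a ≤ n → t b ≤ n → ρ.valid n →
      (∀ s, t a ≤ s → t b ≤ s → s < n → ¬ ∃ l, ρ.lb s = (a, b, l)) →
      (∀ s, t a ≤ s → s < n → ¬ ρ.Acts a s) ∧ (∀ s, t b ≤ s → s < n → ¬ ρ.Acts b s) := by
    intro n hna hnb hn hno
    constructor
    · refine EnvPath.idle_of_no_comm hA (fun s hs hT hact => hact.lb_of_sendH hs hT hAn) hn ?_
      rintro s has hsn ⟨l, hl⟩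
      have hsync := h.sync s
      simp only [hl] at hsync
      exact hno s has (by omega) hsn ⟨l, hl⟩
    · refine EnvPath.idle_of_no_comm hB (fun s hs hT hact => hact.lb_of_recvH hs hT hBn) hn ?_
      rintro s hbs hsn ⟨l, hl⟩
      have hsync := h.sync s
      simp only [hl] at hsync
      exact hno s (by omega) hbs hsn ⟨l, hl⟩
  have hvalid : ρ.valid (max (t a) (t b)) := by
    rcases max_choice (t a) (t b) with hm | hm <;> rw [hm]
    exacts [h.valid a, h.valid b]
  have henabled : CanE (ρ.st (max (t a) (t b))) (.commL a b i) := by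
    obtain ⟨ha, hb⟩ := idle _ (le_max_left _ _) (le_max_right _ _) hvalid (by omega)
    exact CommReady.canE ⟨hab, cs, cs, S, S, hAn, hi, hBn, hi, .refl S⟩
      (EnvPath.envFin_st hfin hvalid)
      ((EnvPath.st_eq_of_idle (le_max_left _ _) hvalid ha).trans hA)
      ((EnvPath.st_eq_of_idle (le_max_right _ _) hvalid hb).trans hB)
  have hex : ∃ m, max (t a) (t b) ≤ m ∧ ρ.alive m ∧ ∃ l, ρ.lb m = (a, b, l) :=
    hfair _ a b hvalid ⟨i, henabled⟩
  obtain ⟨hle, halive, k, hk⟩ := Nat.find_spec hex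
  have hmin : ∀ s, s < Nat.find hex → ¬ _ := fun s hs => Nat.find_min hex hs
  generalize Nat.find hex = m at hle halive hk hmin
  have hma : t a ≤ m := (le_max_left _ _).trans hle
  have hmb : t b ≤ m := (le_max_right _ _).trans hle
  have hmv := ρ.valid_of_alive halive
  obtain ⟨ha, hb⟩ := idle m hma hmb hmv fun s h₁ h₂ hs hl =>
    hmin s hs ⟨max_le h₁ h₂, EnvPath.alive_of_lt hs hmv, hl⟩
  have hstep := ρ.step m halive
  rw [hk] at hstep
  obtain ⟨A', B', hA', hB', ⟨-, cs', _, S', _, hAn', hk', -⟩, hAs, hBs, hother⟩ := hstep.commL_inv_s5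
  rw [EnvPath.st_eq_of_idle hma hmv ha, hA] at hA'; cases hA'
  rw [EnvPath.st_eq_of_idle hmb hmv hb, hB] at hB'; cases hB'
  rw [hAn] at hAn'; cases hAn'
  refine ⟨m, k, S', hk', hma, hmb, halive, hk, ha, hb, ?_, ?_, ?_, ?_⟩
  · intro p
    simp only [Function.update_apply]
    split_ifs
    exacts [halive, halive, h.valid p]
  · intro s
    have hs := h.sync s
    by_cases hsm : s = m
    · subst hsm; simp [hk, hab]
    have key : ∀ r, ρ.Acts r s →
        (s < Function.update (Function.update t a (m + 1)) b (m + 1) r ↔ s < t r) := by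
      intro r hr
      simp only [Function.update_apply]
      split_ifs with h₁ h₂
      · subst h₁
        have := hb s
        by_contra hcon
        exact this (by omega) (by omega) hr
      · subst h₂
        have := ha s
        by_contra hcon
        exact this (by omega) (by omega) hr
      · rfl
    rw [key _ (.inl rfl), key _ (.inr rfl), hs]
  · intro p T hT
    by_cases hpb : p = b
    · subst hpb
      simp only [Function.update_self, hBs] at hT
      cases hT
      exact hBc k S' hk'
    by_cases hpa : p = a
    · subst hpa
      simp only [Function.update_self, Function.update_of_ne hpb, hAs] at hT
      cases hT
      exact hAc k S' hk'
    · simp only [Function.update_of_ne hpb, Function.update_of_ne hpa] at hT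
      exact (h.proj p T hT).unfold.2.2.2 a b cs hG hpa hpb k S' hk'
  · intro p hp
    by_cases hpb : p = b
    · subst hpb; simp [hBs]
    by_cases hpa : p = a
    · subst hpa; simp [hpb, hAs]
    · simpa [hpb, hpa] using h.dom p (.there hG hk' hp)

/-- A participant that is active at index `n` has its next action after reaching `G`
at some index of a fair path, provided it occurs at bounded depth in `G`. -/
theorem Reaches.exists_next_act {ρ : EnvPath} (hfair : FairEPath ρ) (hfin : EnvFin (ρ.st 0))
    {G₀ : Gtt} {p : Prt} {d : ℕ} {G : Gtt} (hocc : Occ p d G) (hsub : Subtree G₀ G)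
    {t : Prt → ℕ} (h : Reaches ρ t G) (hact : ρ.Active p (t p)) :
    ∃ m, t p ≤ m ∧ ρ.alive m ∧ ρ.Acts p m ∧ (∀ s, t p ≤ s → s < m → ¬ ρ.Acts p s) ∧
      ∃ t' G', Reaches ρ t' G' ∧ Subtree G₀ G' ∧ t' p = m + 1 := by
  have atRoot : ∀ {G : Gtt} {a b cs} {t : Prt → ℕ}, Subtree G₀ G → Reaches ρ t G →
      ρ.Active p (t p) → G.node [] = some (.commH a b cs) → (p = a ∨ p = b) →
      ∃ m, t p ≤ m ∧ ρ.alive m ∧ ρ.Acts p m ∧ (∀ s, t p ≤ s → s < m → ¬ ρ.Acts p s) ∧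
        ∃ t' G', Reaches ρ t' G' ∧ Subtree G₀ G' ∧ t' p = m + 1 := by
    rintro G a b cs t hsub h ⟨T, hd, i, hT, hTn, hbr⟩ hG hp
    have hpart : ∃ S, cs[i]? = some (some S) := by
      rcases hp with rfl | rfl
      · rw [((h.proj p T hT).unfold.2.2.1 b cs hG).1] at hTn
        cases hTn; exact hbr
      · rw [((h.proj p T hT).unfold.2.1 a cs hG).1] at hTn
        cases hTn; exact hbr
    obtain ⟨S, hi⟩ := hpart
    obtain ⟨m, k, S', hk, hma, hmb, halive, hlb, hia, hib, hnext⟩ := h.exists_next hfair hfin hG hi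
    rcases hp with rfl | rfl
    · exact ⟨m, hma, halive, .inl (by simp [hlb]), hia, _, _, hnext, hsub.child hG hk,
        by simp [Function.update_apply]⟩
    · exact ⟨m, hmb, halive, .inr (by simp [hlb]), hib, _, _, hnext, hsub.child hG hk, by simp⟩
  induction hocc generalizing t with
  | here hG hp => exact atRoot hsub h hact hG hp
  | @step d G a b cs hG _ ih =>
    by_cases hp : p = a ∨ p = b
    · exact atRoot hsub h hact hG hp
    have hpart : IsPart p G := by
      by_contra hnot
      obtain ⟨T, hd, i, hT, hTn, hbr⟩ := hact
      rw [(h.proj p T hT).unfold.1 hnot] at hTn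
      cases hTn; exact hbr
    obtain ⟨i, S, hi⟩ : ∃ i S, cs[i]? = some (some S) := by
      cases hpart with
      | here hG' hp' => rw [hG] at hG'; cases hG'; exact absurd hp' hp
      | there hG' hi _ => rw [hG] at hG'; cases hG'; exact ⟨_, _, hi⟩
    obtain ⟨m, k, S', hk, -, -, -, -, -, -, hnext⟩ := h.exists_next hfair hfin hG hi
    have htp : Function.update (Function.update t a (m + 1)) b (m + 1) p = t p := by
      rw [not_or] at hp
      simp [hp.1, hp.2]
    have := ih k S' hk (hsub.child hG hk) hnext (by rwa [htp])
    rwa [htp] at this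

/-- On a fair path realising a balanced global type, active participants eventually act. -/
theorem Reaches.exists_act {ρ : EnvPath} (hfair : FairEPath ρ) (hfin : EnvFin (ρ.st 0))
    {G₀ : Gtt} (hbal : BalancedG G₀) {p : Prt} {n : ℕ} (hn : ρ.valid n) (hact : ρ.Active p n)
    {G : Gtt} (hsub : Subtree G₀ G) {t : Prt → ℕ} (h : Reaches ρ t G) (htn : t p ≤ n) :
    ∃ m, n ≤ m ∧ ρ.alive m ∧ ρ.Acts p m ∧ ρ.st m p = ρ.st n p := by
  induction hd : n - t p using Nat.strong_induction_on generalizing t G with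
  | _ d ih =>
    have hact' := hact.of_le htn hn
    have hpart : IsPart p G := by
      by_contra hnot
      obtain ⟨T, hd, i, hT, hTn, hbr⟩ := hact'
      rw [(h.proj p T hT).unfold.1 hnot] at hTn
      cases hTn; exact hbr
    obtain ⟨k, hk⟩ := hbal G hsub
    obtain ⟨m, hm, halive, hpm, hidle, t', G', h', hsub', ht'⟩ :=
      h.exists_next_act hfair hfin (hk p hpart) hsub hact'
    by_cases hnm : n ≤ m
    · exact ⟨m, hnm, halive, hpm, EnvPath.st_eq_of_idle hnm (ρ.valid_of_alive halive)
        fun s h₁ h₂ => hidle s (htn.trans h₁) h₂⟩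
    · exact ih _ (by omega) hsub' h' (by omega) rfl

/-- **Liveness of the projection environment.** If `G` is a balanced, projectable global
type tree, then the environment `Γproj = { p : G↾p | p ∈ parts(G) }` of direct
projections of `G` is a live environment. -/
theorem projection_env_live (G : Gtt) (Γproj : Env)
    (hbal : BalancedG G) (hproj : Projectable G) (hfin : EnvFin Γproj)
    (hpe : IsProjEnv G Γproj) :
    LiveEnv Γproj := by
  refine liveEnv_of_fair_paths hfin ?_
  rintro ρ rfl hfair
  have hstart : Reaches ρ (fun _ => 0) G := by
    refine ⟨fun _ => trivial, fun _ => Iff.rfl, fun p T hT => ?_, fun p hp => ?_⟩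
    · by_cases hp : IsPart p G
      · obtain ⟨T', hT', hproj'⟩ := hpe.1 p hp
        rw [hT] at hT'; cases hT'
        exact hproj'
      · simp [hpe.2 p hp] at hT
    · obtain ⟨T, hT, -⟩ := hpe.1 p hp
      simp [hT]
  refine fun n hn => ⟨fun p q S l hc => ?_, fun p q S l hc => ?_⟩
  · obtain ⟨_, hc⟩ := hc
    obtain ⟨T, cs, hT, hTn, hl, -⟩ := hc.sendL_inv
    obtain ⟨m, hnm, halive, hpm, hst⟩ := hstart.exists_act hfair hfin hbal hn
      ⟨T, _, l, hT, hTn, S, hl⟩ (.refl G) n.zero_le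
    exact ⟨m, hnm, halive, hpm.lb_of_sendH halive (hst.trans hT) hTn⟩
  · obtain ⟨_, hc⟩ := hc
    obtain ⟨T, cs, hT, hTn, hl, -⟩ := hc.recvL_inv
    obtain ⟨m, hnm, halive, hpm, hst⟩ := hstart.exists_act hfair hfin hbal hn
      ⟨T, _, l, hT, hTn, S, hl⟩ (.refl G) n.zero_le
    exact ⟨m, hnm, halive, hpm.lb_of_recvH halive (hst.trans hT) hTn⟩
end
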